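/- arXiv:1308.3728 — 2 statements merged into one kernel-verified Lean document; each statement's English description precedes it below -/
import Mathlib

section
/- If G = (V,D,B) is a chain graph whose bidirected part contains a chordless cycle of length p ≥ 4, then there is no acyclic digraph D' = (U,E) with U ⊇ V such that the set of conditional covariance matrices PD_{[p]}(D'|A) equals PD(B_p); consequently, G is not strictly Gaussian causal. -/
open Matrix BigOperators

def SupportedOn {V : Type} (E : V → V → Prop) (Λ : Matrix V V ℝ) : Prop :=
  ∀ u v, ¬ E u v → Λ u v = 0

def Acyclic {V : Type} (E : V → V → Prop) : Prop :=
  ∀ v, ¬ Relation.TransGen E v v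

def cycAdj (p : ℕ) (i j : Fin p) : Prop :=
  (i.1 + 1) % p = j.1 ∨ (j.1 + 1) % p = i.1

structure Trek {V : Type} (E : V → V → Prop) (u v : V) where
  left : List V
  right : List V
  left_ne : left ≠ []
  right_ne : right ≠ []
  top_eq : left.head left_ne = right.head right_ne
  chain_left : List.Chain' E left
  chain_right : List.Chain' E right
  last_left : left.getLast left_ne = u
  last_right : right.getLast right_ne = v

def Trek.top {V : Type} {E : V → V → Prop} {u v : V} (τ : Trek E u v) : V :=
  τ.left.head τ.left_ne

def edgeProd {V : Type} (Λ : Matrix V V ℝ) (l : List V) : ℝ :=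
  ((l.zip l.tail).map fun p => Λ p.1 p.2).prod

def Trek.mono {V : Type} {E : V → V → Prop} {u v : V} (Λ Ω : Matrix V V ℝ)
    (τ : Trek E u v) : ℝ :=
  Ω τ.top τ.top * edgeProd Λ τ.left * edgeProd Λ τ.right

structure TrekSystem {V : Type} (E : V → V → Prop) {n : ℕ} (x y : Fin n → V) where
  perm : Equiv.Perm (Fin n)
  trek : ∀ i, Trek E (x i) (y (perm i))

def TrekSystem.NoSided {V : Type} {E : V → V → Prop} {n : ℕ} {x y : Fin n → V}
    (S : TrekSystem E x y) : Prop :=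
  ∀ i j, i ≠ j →
    (∀ a : V, ¬(a ∈ (S.trek i).left ∧ a ∈ (S.trek j).left)) ∧
    (∀ a : V, ¬(a ∈ (S.trek i).right ∧ a ∈ (S.trek j).right))

structure DWalk {U : Type} (E : U → U → Prop) (u v : U) where
  steps : List (Bool × U × U)
  ne : steps ≠ []
  first_eq : (steps.head ne).2.1 = u
  last_eq : (steps.getLast ne).2.2 = v
  edge : ∀ s ∈ steps, (s.1 = true → E s.2.1 s.2.2) ∧ (s.1 = false → E s.2.2 s.2.1)
  chain : List.Chain' (fun s t : Bool × U × U => s.2.2 = t.2.1) steps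

def stepPairOK {U : Type} (A : Set U) (s t : Bool × U × U) : Prop :=
  ((s.1 = true ∧ t.1 = false) → s.2.2 ∈ A) ∧ (¬(s.1 = true ∧ t.1 = false) → s.2.2 ∉ A)

def DWalk.DConn {U : Type} {E : U → U → Prop} {u v : U} (A : Set U)
    (w : DWalk E u v) : Prop :=
  List.Chain' (stepPairOK A) w.steps

def topOf {U : Type} : List (Bool × U × U) → U → U
  | [], u => u
  | (d, a, _b) :: rest, _ => if d then a else topOf rest _b

def DWalk.top {U : Type} {E : U → U → Prop} {u v : U} (w : DWalk E u v) : U :=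
  topOf w.steps u

def TopsA {U : Type} (E : U → U → Prop) (A : Set U) (u v : U) : Set U :=
  {t | ∃ w : DWalk E u v, w.DConn A ∧ w.top = t}

def anAvoid {U : Type} (E : U → U → Prop) (A : Set U) (x : U) : Set U :=
  {u | u ∉ A ∧ Relation.ReflTransGen (fun a b => E a b ∧ a ∉ A ∧ b ∉ A) u x}

def EA {U : Type} (E : U → U → Prop) (A : Set U) (n1 n2 : U) : Set (U × U) :=
  {e | E e.1 e.2 ∧ e.1 ∈ TopsA E A n1 n2 ∧ e.2 ∈ anAvoid E A n1 ∧ e.2 ∉ TopsA E A n1 n2}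

def IsProperPath {U : Type} (E : U → U → Prop) (A : Set U) (l : List U) : Prop :=
  l ≠ [] ∧ List.Chain' (fun a b => E a b ∧ a ∉ A) l

def DigraphCov {U : Type} [Fintype U] [DecidableEq U] (E : U → U → Prop) :
    Set (Matrix U U ℝ) :=
  {S | ∃ Λ Ω : Matrix U U ℝ, SupportedOn E Λ ∧ Ω.IsDiag ∧ (∀ u, 0 < Ω u u) ∧
        S = ((1 - Λ)⁻¹)ᵀ * Ω * (1 - Λ)⁻¹}

def BSupported {V : Type} (B : SimpleGraph V) (Ω : Matrix V V ℝ) : Prop :=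
  ∀ u v, u ≠ v → ¬ B.Adj u v → Ω u v = 0

def MixedCov {V : Type} [Fintype V] [DecidableEq V] (D : V → V → Prop)
    (B : SimpleGraph V) : Set (Matrix V V ℝ) :=
  {S | ∃ Λ Ω : Matrix V V ℝ, SupportedOn D Λ ∧ Ω.PosDef ∧ BSupported B Ω ∧
        S = ((1 - Λ)⁻¹)ᵀ * Ω * (1 - Λ)⁻¹}

def StrictlyGaussianCausal {V : Type} [Fintype V] [DecidableEq V]
    (D : V → V → Prop) (B : SimpleGraph V) : Prop :=
  ∃ (U : Type) (iF : Fintype U) (iD : DecidableEq U) (ι : V ↪ U) (E : U → U → Prop),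
    Acyclic E ∧
      (fun S : Matrix U U ℝ => S.submatrix ι ι) '' (@DigraphCov U iF iD E) = MixedCov D B

def Chordal {V : Type} (B : SimpleGraph V) : Prop :=
  ∀ n : ℕ, 4 ≤ n → ∀ f : ZMod n → V, Function.Injective f →
    (∀ i, B.Adj (f i) (f (i + 1))) →
    ∃ i j : ZMod n, j ≠ i + 1 ∧ i ≠ j + 1 ∧ i ≠ j ∧ B.Adj (f i) (f j)

def ChainGraph {V : Type} (D : V → V → Prop) (B : SimpleGraph V) : Prop :=
  ¬ ∃ u v, D u v ∧ Relation.ReflTransGen (fun a b => D a b ∨ B.Adj a b) v u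


def ancSet {V : Type} (D : V → V → Prop) (B : SimpleGraph V) (c0 : V) : Set V :=
  {u | ¬ B.Reachable c0 u ∧ ∃ c, B.Reachable c0 c ∧ Relation.ReflTransGen D u c}

open scoped Classical in
def condCovSet {V U : Type} [Fintype V] [DecidableEq V] [Fintype U] [DecidableEq U]
    (E : U → U → Prop) (ι : V ↪ U) (A : Set V) (p : ℕ) (cyc : Fin p ↪ V) :
    Set (Matrix (Fin p) (Fin p) ℝ) :=
  {Φ | ∃ S ∈ DigraphCov E, ∀ i j : Fin p,
      Φ i j = S (ι (cyc i)) (ι (cyc j)) -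
        ∑ a : ↥A, ∑ b : ↥A,
          S (ι (cyc i)) (ι a.1) *
            (Matrix.of fun a b : ↥A => S (ι a.1) (ι b.1))⁻¹ a b * S (ι b.1) (ι (cyc j))}


section Helpers

theorem aux_rank {U : Type} [Fintype U] {E : U → U → Prop} (hE : Acyclic E) :
    ∃ r : U → ℕ, (∀ u v, E u v → r u < r v) ∧ ∃ N, ∀ u, r u < N := by
  classical
  refine ⟨fun v => (Finset.univ.filter fun u => Relation.TransGen E u v).card, ?_,
    Fintype.card U + 1, ?_⟩
  · intro u v huv
    apply Finset.card_lt_card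
    rw [Finset.ssubset_iff_of_subset]
    · refine ⟨u, by simpa using Relation.TransGen.single huv, by simpa using hE u⟩
    · intro x hx
      simp only [Finset.mem_filter, Finset.mem_univ, true_and] at hx ⊢
      exact hx.tail huv
  · intro u
    exact Nat.lt_succ_of_le (Finset.card_le_univ _)

theorem aux_pow_supp {U : Type} [Fintype U] [DecidableEq U] {E : U → U → Prop}
    {Λ : Matrix U U ℝ} (hΛ : SupportedOn E Λ) (n : ℕ) (u v : U) (h : (Λ ^ n) u v ≠ 0) :
    Relation.ReflTransGen E u v ∧ ∀ r : U → ℕ, (∀ u v, E u v → r u < r v) → r u + n ≤ r v := by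
  induction n generalizing v with
  | zero =>
    have : u = v := by
      by_contra hne
      apply h
      simp [Matrix.one_apply_ne hne]
    subst this
    exact ⟨Relation.ReflTransGen.refl, fun r _ => by simp⟩
  | succ n ih =>
    rw [pow_succ, Matrix.mul_apply] at h
    obtain ⟨w, -, hw⟩ := Finset.exists_ne_zero_of_sum_ne_zero h
    have h1 := ih w (left_ne_zero_of_mul hw)
    have h2 : E w v := by
      by_contra hne
      exact right_ne_zero_of_mul hw (hΛ _ _ hne)
    refine ⟨h1.1.tail h2, fun r hr => ?_⟩
    have := h1.2 r hr
    have := hr _ _ h2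
    omega

theorem aux_inv {U : Type} [Fintype U] [DecidableEq U] {E : U → U → Prop} (hE : Acyclic E)
    {Λ : Matrix U U ℝ} (hΛ : SupportedOn E Λ) :
    (1 - Λ) * (1 - Λ)⁻¹ = 1 ∧ (1 - Λ)⁻¹ * (1 - Λ) = 1 ∧
    (∀ u v, (1 - Λ)⁻¹ u v ≠ 0 → Relation.ReflTransGen E u v) ∧
    ((∀ u v, 0 ≤ Λ u v) → ∀ u v, 0 ≤ (1 - Λ)⁻¹ u v) := by
  obtain ⟨r, hr, N, hN⟩ := aux_rank hE
  have hz : Λ ^ N = 0 := by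
    ext u v
    by_contra h
    have := (aux_pow_supp hΛ N u v h).2 r hr
    have := hN v
    omega
  have h1 : (1 - Λ) * ∑ i ∈ Finset.range N, Λ ^ i = 1 := by
    rw [mul_neg_geom_sum, hz, sub_zero]
  have h2 := Matrix.inv_eq_right_inv h1
  rw [h2]
  refine ⟨h1, mul_eq_one_comm.mp h1, ?_, ?_⟩
  · intro u v h
    rw [Matrix.sum_apply] at h
    obtain ⟨i, -, hi⟩ := Finset.exists_ne_zero_of_sum_ne_zero h
    exact (aux_pow_supp hΛ i u v hi).1
  · intro hpos u v
    rw [Matrix.sum_apply]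
    apply Finset.sum_nonneg
    intro i hi; clear hi
    clear h1 h2 hz
    induction i generalizing v with
    | zero =>
      rw [pow_zero, Matrix.one_apply]; split_ifs <;> norm_num
    | succ n ih =>
      rw [pow_succ, Matrix.mul_apply]
      exact Finset.sum_nonneg fun w _ => mul_nonneg (ih w) (hpos _ _)

theorem aux_sub_mul {U W A I J : Type} [Fintype U] [Fintype W] [Fintype A]
    (w : W → U) (a : A → U)
    (hsum : ∀ f : U → ℝ, ∑ u, f u = ∑ x, f (w x) + ∑ y, f (a y))
    (X Y : Matrix U U ℝ) (f : I → U) (g : J → U) :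
    (X * Y).submatrix f g = X.submatrix f w * Y.submatrix w g
      + X.submatrix f a * Y.submatrix a g := by
  ext i j
  simp [Matrix.mul_apply, hsum]

theorem aux_posdef {U : Type} [Fintype U] [DecidableEq U] {E : U → U → Prop} (hE : Acyclic E)
    {Λ Ω : Matrix U U ℝ} (hΛ : SupportedOn E Λ) (hΩ : Ω.PosDef) :
    (((1 - Λ)⁻¹)ᵀ * Ω * (1 - Λ)⁻¹).PosDef := by
  have h := aux_inv hE hΛ
  have := hΩ.conjTranspose_mul_mul_same (B := (1 - Λ)⁻¹) (by
    intro x y hxy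
    have := congrArg (fun z => (1 - Λ) *ᵥ z) hxy
    simpa [Matrix.mulVec_mulVec, h.1] using this)
  rwa [Matrix.conjTranspose_eq_transpose_of_trivial] at this

theorem aux_cond {U W A : Type} [Fintype U] [DecidableEq U] [Fintype W] [Fintype A]
    [DecidableEq W] [DecidableEq A] {E : U → U → Prop} (hE : Acyclic E)
    (w : W → U) (a : A → U) (hw : Function.Injective w) (ha : Function.Injective a)
    (hwa : ∀ x y, w x ≠ a y)
    (hsum : ∀ f : U → ℝ, ∑ u, f u = ∑ x, f (w x) + ∑ y, f (a y))
    {Λ : Matrix U U ℝ} (hΛ : SupportedOn E Λ) (d : U → ℝ) (hd : ∀ u, 0 < d u)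
    (S : Matrix U U ℝ) (hS : S = ((1 - Λ)⁻¹)ᵀ * diagonal d * (1 - Λ)⁻¹)
    (M : Matrix W W ℝ) (hM : M = (1 - Λ.submatrix w w)⁻¹)
    (g : Matrix W A ℝ) (hg : g = M * Λ.submatrix w a) :
    S.submatrix w w - S.submatrix w a * (S.submatrix a a)⁻¹ * S.submatrix a w =
    Mᵀ * (diagonal (fun x => (d (w x))⁻¹) + g * diagonal (fun y => (d (a y))⁻¹) * gᵀ)⁻¹ * M := by
  have hEw : Acyclic (fun x y => E (w x) (w y)) := by
    intro v hv
    exact hE (w v) (Relation.TransGen.lift w (fun _ _ h => h) _ _ hv)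
  have hΛw : SupportedOn (fun x y => E (w x) (w y)) (Λ.submatrix w w) :=
    fun u v h => hΛ _ _ h
  obtain ⟨h1, h2, -, -⟩ := aux_inv hE hΛ
  obtain ⟨m1, m2, -, -⟩ := aux_inv hEw hΛw
  rw [← hM] at m1 m2
  have hpd : S.PosDef := by
    rw [hS]; exact aux_posdef hE hΛ (PosDef.diagonal hd)
  have hdd : diagonal d * diagonal (fun u => (d u)⁻¹) = (1 : Matrix U U ℝ) := by
    rw [diagonal_mul_diagonal, ← diagonal_one]
    congr 1; ext u; exact mul_inv_cancel₀ (hd u).ne'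
  set K := (1 - Λ) * diagonal (fun u => (d u)⁻¹) * (1 - Λ)ᵀ with hK
  have hSK : S * K = 1 := by
    have h3 : ((1 - Λ)⁻¹)ᵀ * (1 - Λ)ᵀ = 1 := by
      rw [← Matrix.transpose_mul, h1, Matrix.transpose_one]
    calc S * K = ((1 - Λ)⁻¹)ᵀ * (diagonal d * (((1 - Λ)⁻¹ * (1 - Λ)) * diagonal (fun u => (d u)⁻¹))) * (1 - Λ)ᵀ := by
          rw [hS, hK]; simp only [Matrix.mul_assoc]
      _ = 1 := by rw [h2, Matrix.one_mul, hdd, Matrix.mul_one, h3]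
  have hA : IsUnit (S.submatrix a a).det := (hpd.submatrix ha).det_pos.ne'.isUnit
  have b1 : S.submatrix w w * K.submatrix w w + S.submatrix w a * K.submatrix a w = 1 := by
    rw [← aux_sub_mul w a hsum, hSK, Matrix.submatrix_one w hw]
  have b2 : S.submatrix a w * K.submatrix w w + S.submatrix a a * K.submatrix a w = 0 := by
    rw [← aux_sub_mul w a hsum, hSK]
    ext y x
    simp [(hwa x y).symm]
  have b3 : (S.submatrix w w - S.submatrix w a * (S.submatrix a a)⁻¹ * S.submatrix a w)
      * K.submatrix w w = 1 := by
    have e : S.submatrix a w * K.submatrix w w = - (S.submatrix a a * K.submatrix a w) :=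
      eq_neg_of_add_eq_zero_left b2
    rw [Matrix.sub_mul, Matrix.mul_assoc, e, Matrix.mul_assoc, Matrix.mul_neg,
      Matrix.nonsing_inv_mul_cancel_left _ _ hA, Matrix.mul_neg, sub_neg_eq_add, b1]
  have q1 : (1 - Λ).submatrix w w = 1 - Λ.submatrix w w := by
    rw [Matrix.submatrix_sub, Pi.sub_apply, Pi.sub_apply, Matrix.submatrix_one w hw]
  have q2 : (1 - Λ).submatrix w a = - Λ.submatrix w a := by
    ext x y; simp [hwa x y]
  have q3 : K.submatrix w w = (1 - Λ.submatrix w w) * diagonal (fun x => (d (w x))⁻¹)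
      * (1 - Λ.submatrix w w)ᵀ + Λ.submatrix w a * diagonal (fun y => (d (a y))⁻¹)
      * (Λ.submatrix w a)ᵀ := by
    rw [hK, aux_sub_mul w a hsum, aux_sub_mul w a hsum, aux_sub_mul w a hsum,
      ← Matrix.transpose_submatrix, ← Matrix.transpose_submatrix, q1, q2,
      Matrix.submatrix_diagonal _ w hw, Matrix.submatrix_diagonal _ a ha]
    have z1 : (diagonal (fun u => (d u)⁻¹)).submatrix a w = 0 := by
      ext y x; simp [(hwa x y).symm]
    have z2 : (diagonal (fun u => (d u)⁻¹)).submatrix w a = 0 := by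
      ext y x; simp [hwa y x]
    rw [z1, z2]
    simp [Function.comp_def]
  set Q := diagonal (fun x => (d (w x))⁻¹) + g * diagonal (fun y => (d (a y))⁻¹) * gᵀ with hQ
  have q4 : K.submatrix w w = (1 - Λ.submatrix w w) * Q * (1 - Λ.submatrix w w)ᵀ := by
    have hg1 : (1 - Λ.submatrix w w) * g = Λ.submatrix w a := by
      rw [hg, ← Matrix.mul_assoc, m1, Matrix.one_mul]
    rw [q3, hQ, Matrix.mul_add, Matrix.add_mul, ← hg1, Matrix.transpose_mul]
    simp only [Matrix.mul_assoc]
  have hQpd : Q.PosDef := by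
    apply PosDef.add_posSemidef
    · exact PosDef.diagonal fun x => inv_pos.mpr (hd _)
    · have := (PosDef.diagonal (R := ℝ) (d := fun y => (d (a y))⁻¹)
        fun y => inv_pos.mpr (hd _)).posSemidef.mul_mul_conjTranspose_same g
      simpa using this
  have hQu : IsUnit Q.det := hQpd.det_pos.ne'.isUnit
  have b4 : (Mᵀ * Q⁻¹ * M) * K.submatrix w w = 1 := by
    have m3 : Mᵀ * (1 - Λ.submatrix w w)ᵀ = 1 := by
      rw [← Matrix.transpose_mul, m1, Matrix.transpose_one]
    calc _ = Mᵀ * (Q⁻¹ * ((M * (1 - Λ.submatrix w w)) * Q)) * (1 - Λ.submatrix w w)ᵀ := by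
          rw [q4]; simp only [Matrix.mul_assoc]
      _ = 1 := by rw [m2, Matrix.one_mul, Matrix.nonsing_inv_mul _ hQu, Matrix.mul_one, m3]
  rw [← Matrix.inv_eq_left_inv b3, ← Matrix.inv_eq_left_inv b4]

theorem aux_mask {W : Type} [Fintype W] [DecidableEq W] (Q : Matrix W W ℝ)
    (hQ : IsUnit Q.det) (C : W → W → Prop) (hrefl : ∀ x, C x x)
    (hsymm : ∀ x y, C x y → C y x) (htrans : ∀ x y z, C x y → C y z → C x z)
    (hsupp : ∀ x y, Q x y ≠ 0 → C x y) (x y : W) (h : Q⁻¹ x y ≠ 0) : C x y := by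
  classical
  set P' : Matrix W W ℝ := Matrix.of fun x y => if C x y then Q⁻¹ x y else 0 with hP'
  have h1 : Q * P' = 1 := by
    have hQQ := Matrix.mul_nonsing_inv Q hQ
    ext x z
    rw [Matrix.mul_apply]
    by_cases hxz : C x z
    · rw [← hQQ, Matrix.mul_apply]
      refine Finset.sum_congr rfl fun y _ => ?_
      by_cases hq : Q x y = 0
      · simp [hq]
      · have : C y z := htrans _ _ _ (hsymm _ _ (hsupp _ _ hq)) hxz
        simp [hP', this]
    · have hne : x ≠ z := by rintro rfl; exact hxz (hrefl _)
      rw [Matrix.one_apply_ne hne]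
      refine Finset.sum_eq_zero fun y _ => ?_
      by_cases hq : Q x y = 0
      · simp [hq]
      · have : ¬ C y z := fun hc => hxz (htrans _ _ _ (hsupp _ _ hq) hc)
        simp [hP', this]
  rw [Matrix.inv_eq_right_inv h1] at h
  by_contra hc
  apply h
  simp [hP', hc]

theorem aux_limit {W : Type} [Fintype W] [DecidableEq W] (G : Matrix W W ℝ)
    (hG : ∀ s : ℝ, 0 < s → IsUnit (1 + s • G).det)
    (f h : W → ℝ) (hz : ∀ s : ℝ, 0 < s → f ⬝ᵥ ((1 + s • G)⁻¹ *ᵥ h) = 0) (n : ℕ) :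
    f ⬝ᵥ ((G ^ n) *ᵥ h) = 0 := by
  have base : ∀ f : W → ℝ, (∀ s : ℝ, 0 < s → f ⬝ᵥ ((1 + s • G)⁻¹ *ᵥ h) = 0) → f ⬝ᵥ h = 0 := by
    intro f hf
    have h1 : ∀ s : ℝ, 0 < s → f ⬝ᵥ ((1 + s • G).adjugate *ᵥ h) = 0 := by
      intro s hs
      have := hf s hs
      rw [Matrix.inv_def, Matrix.smul_mulVec, dotProduct_smul, smul_eq_mul] at this
      rcases mul_eq_zero.mp this with h0 | h0
      · exfalso
        have := hG s hs
        rw [Ring.inverse_eq_inv', inv_eq_zero] at h0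
        exact this.ne_zero h0
      · exact h0
    have hc : Continuous fun s : ℝ => f ⬝ᵥ ((1 + s • G).adjugate *ᵥ h) := by
      have : Continuous fun s : ℝ => (1 + s • G).adjugate :=
        Continuous.matrix_adjugate (by fun_prop)
      exact Continuous.dotProduct continuous_const (Continuous.matrix_mulVec this continuous_const)
    have h2 := (hc.tendsto 0).mono_left (nhdsWithin_le_nhds (s := Set.Ioi 0))
    have h3 : Filter.Tendsto (fun s : ℝ => f ⬝ᵥ ((1 + s • G).adjugate *ᵥ h))
        (nhdsWithin 0 (Set.Ioi 0)) (nhds 0) := by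
      apply tendsto_const_nhds.congr'
      filter_upwards [self_mem_nhdsWithin] with s hs
      exact (h1 s hs).symm
    have := tendsto_nhds_unique h2 h3
    simpa using this
  have gen : ∀ n : ℕ, ∀ f : W → ℝ, (∀ s : ℝ, 0 < s → f ⬝ᵥ ((1 + s • G)⁻¹ *ᵥ h) = 0) →
      f ⬝ᵥ ((G ^ n) *ᵥ h) = 0 := by
    intro n
    induction n with
    | zero => intro f hf; simpa using base f hf
    | succ n ih =>
      intro f hf
      have := ih (f ᵥ* G) (by
        intro s hs
        have e : G * (1 + s • G)⁻¹ = s⁻¹ • (1 - (1 + s • G)⁻¹) := by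
          have e1 : (1 + s • G) * (1 + s • G)⁻¹ = 1 := Matrix.mul_nonsing_inv _ (hG s hs)
          rw [Matrix.add_mul, Matrix.one_mul, Matrix.smul_mul] at e1
          rw [← eq_sub_of_add_eq' e1, smul_smul, inv_mul_cancel₀ hs.ne', one_smul]
        rw [← Matrix.dotProduct_mulVec, Matrix.mulVec_mulVec, e, Matrix.smul_mulVec,
          Matrix.sub_mulVec, Matrix.one_mulVec, dotProduct_smul, dotProduct_sub, hf s hs,
          base f hf]
        simp)
      rw [← Matrix.dotProduct_mulVec, Matrix.mulVec_mulVec, ← pow_succ'] at this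
      exact this
  exact gen n f hz

theorem aux_pow_pos {W : Type} [Fintype W] [DecidableEq W] (G : Matrix W W ℝ)
    (hG : ∀ x y, 0 ≤ G x y) (R : W → W → Prop) (hR : ∀ x y, R x y → 0 < G x y)
    (x y : W) (h : Relation.ReflTransGen R x y) :
    ∃ n : ℕ, (∀ x y, 0 ≤ (G ^ n) x y) ∧ 0 < (G ^ n) x y := by
  induction h with
  | refl => exact ⟨0, fun x y => by rw [pow_zero, Matrix.one_apply]; split_ifs <;> norm_num, by simp⟩
  | @tail b c _ hbc ih =>
    obtain ⟨n, h0, h1⟩ := ih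
    refine ⟨n + 1, fun x y => ?_, ?_⟩
    · rw [pow_succ, Matrix.mul_apply]
      exact Finset.sum_nonneg fun z _ => mul_nonneg (h0 _ _) (hG _ _)
    · rw [pow_succ, Matrix.mul_apply]
      exact Finset.sum_pos' (fun z _ => mul_nonneg (h0 _ _) (hG _ _))
        ⟨b, Finset.mem_univ _, mul_pos h1 (hR _ _ hbc)⟩

theorem aux_inv_pos {U : Type} [Fintype U] [DecidableEq U] {E : U → U → Prop} (hE : Acyclic E)
    {Λ : Matrix U U ℝ} (hΛ : SupportedOn E Λ) (h0 : ∀ u v, 0 ≤ Λ u v)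
    (h1 : ∀ u v, E u v → 0 < Λ u v) (u v : U) (h : Relation.ReflTransGen E u v) :
    0 < (1 - Λ)⁻¹ u v := by
  obtain ⟨i1, i2, -, i4⟩ := aux_inv hE hΛ
  have hn := i4 h0
  have e : (1 - Λ)⁻¹ = 1 + Λ * (1 - Λ)⁻¹ := by
    rw [Matrix.sub_mul, Matrix.one_mul] at i1
    exact sub_eq_iff_eq_add.mp i1
  induction h using Relation.ReflTransGen.head_induction_on with
  | refl =>
    rw [e, Matrix.add_apply, Matrix.one_apply_eq, Matrix.mul_apply]
    have := Finset.sum_nonneg fun z (_ : z ∈ Finset.univ) => mul_nonneg (h0 v z) (hn z v)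
    linarith
  | @head a b hab _ ih =>
    rw [e, Matrix.add_apply, Matrix.mul_apply]
    have : 0 < ∑ z, Λ a z * (1 - Λ)⁻¹ z v :=
      Finset.sum_pos' (fun z _ => mul_nonneg (h0 a z) (hn z v))
        ⟨b, Finset.mem_univ _, mul_pos (h1 _ _ hab) ih⟩
    have h3 : (0:ℝ) ≤ (1 : Matrix U U ℝ) a v := by
      rw [Matrix.one_apply]; split_ifs <;> norm_num
    linarith

def auxReach {U W : Type} (E : U → U → Prop) (w : W → U) (x y : W) : Prop :=
  Relation.ReflTransGen (fun x y => E (w x) (w y)) x y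

def auxR {U W A : Type} (E : U → U → Prop) (w : W → U) (a : A → U) (x y : W) : Prop :=
  ∃ c : A, (∃ b, auxReach E w x b ∧ E (w b) (a c)) ∧ (∃ b, auxReach E w y b ∧ E (w b) (a c))

def auxConn {U W A : Type} (E : U → U → Prop) (w : W → U) (a : A → U) (x y : W) : Prop :=
  Relation.ReflTransGen (auxR E w a) x y

theorem auxConn_symm {U W A : Type} {E : U → U → Prop} {w : W → U} {a : A → U} {x y : W}
    (h : auxConn E w a x y) : auxConn E w a y x := by
  induction h with
  | refl => exact Relation.ReflTransGen.refl
  | tail _ hbc ih =>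
    obtain ⟨c, h1, h2⟩ := hbc
    exact Relation.ReflTransGen.head ⟨c, h2, h1⟩ ih

noncomputable def auxCond {U W A : Type} [Fintype A] [DecidableEq A]
    (w : W → U) (a : A → U) (S : Matrix U U ℝ) : Matrix W W ℝ :=
  S.submatrix w w - S.submatrix w a * (S.submatrix a a)⁻¹ * S.submatrix a w

theorem aux_sep {U W A : Type} [Fintype U] [DecidableEq U] [Fintype W] [Fintype A]
    [DecidableEq W] [DecidableEq A] {E : U → U → Prop} (hE : Acyclic E)
    (w : W → U) (a : A → U) (hw : Function.Injective w) (ha : Function.Injective a)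
    (hwa : ∀ x y, w x ≠ a y)
    (hsum : ∀ f : U → ℝ, ∑ u, f u = ∑ x, f (w x) + ∑ y, f (a y))
    (y y' : W) (hz : ∀ S ∈ DigraphCov E, auxCond w a S y y' = 0)
    (v v' : W) (hc : auxConn E w a v v') (h1 : auxReach E w v y) (h2 : auxReach E w v' y') :
    False := by
  classical
  have hEw : Acyclic (fun x y => E (w x) (w y)) := by
    intro v hv
    exact hE (w v) (Relation.TransGen.lift w (fun _ _ h => h) _ _ hv)
  set Λ : Matrix U U ℝ := Matrix.of fun u v => if E u v then 1 else 0 with hΛdef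
  have hΛ : SupportedOn E Λ := by
    intro u v h; simp [hΛdef, h]
  have hΛ0 : ∀ u v, 0 ≤ Λ u v := by
    intro u v; simp only [hΛdef, Matrix.of_apply]; split_ifs <;> norm_num
  have hΛ1 : ∀ u v, E u v → 0 < Λ u v := by
    intro u v h; simp [hΛdef, h]
  have hΛw : SupportedOn (fun x y => E (w x) (w y)) (Λ.submatrix w w) :=
    fun u v h => hΛ _ _ h
  set M := (1 - Λ.submatrix w w)⁻¹ with hM
  have hM0 : ∀ x y, 0 ≤ M x y := (aux_inv hEw hΛw).2.2.2 fun u v => hΛ0 _ _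
  have hM1 : ∀ x y, auxReach E w x y → 0 < M x y := fun x y h =>
    aux_inv_pos hEw hΛw (fun u v => hΛ0 _ _) (fun u v h => hΛ1 _ _ h) x y h
  set g := M * Λ.submatrix w a with hg
  have hg0 : ∀ x c, 0 ≤ g x c := by
    intro x c
    rw [hg, Matrix.mul_apply]
    exact Finset.sum_nonneg fun z _ => mul_nonneg (hM0 _ _) (hΛ0 _ _)
  have hg1 : ∀ x c, (∃ b, auxReach E w x b ∧ E (w b) (a c)) → 0 < g x c := by
    rintro x c ⟨b, hb, hbc⟩
    rw [hg, Matrix.mul_apply]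
    exact Finset.sum_pos' (fun z _ => mul_nonneg (hM0 _ _) (hΛ0 _ _))
      ⟨b, Finset.mem_univ _, mul_pos (hM1 _ _ hb) (hΛ1 _ _ hbc)⟩
  set G := g * gᵀ with hG
  have hG0 : ∀ x y, 0 ≤ G x y := by
    intro x y
    rw [hG, Matrix.mul_apply]
    exact Finset.sum_nonneg fun z _ => mul_nonneg (hg0 _ _) (hg0 _ _)
  have hG1 : ∀ x y, auxR E w a x y → 0 < G x y := by
    rintro x y ⟨c, hx, hy⟩
    rw [hG, Matrix.mul_apply]
    exact Finset.sum_pos' (fun z _ => mul_nonneg (hg0 _ _) (hg0 _ _))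
      ⟨c, Finset.mem_univ _, mul_pos (hg1 _ _ hx) (hg1 _ _ hy)⟩
  obtain ⟨n, hn0, hn1⟩ := aux_pow_pos G hG0 _ hG1 v v' hc
  have hGpsd : G.PosSemidef := by
    have := posSemidef_self_mul_conjTranspose g
    rwa [Matrix.conjTranspose_eq_transpose_of_trivial] at this
  have hu : ∀ s : ℝ, 0 < s → IsUnit (1 + s • G).det := by
    intro s hs
    have : (1 + s • G).PosDef := PosDef.one.add_posSemidef (hGpsd.smul hs.le)
    exact this.det_pos.ne'.isUnit
  have key := aux_limit G hu (fun x => M x y) (fun x => M x y') (by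
    intro s hs
    set d : U → ℝ := fun u => if u ∈ Set.range a then s⁻¹ else 1 with hd
    have hdpos : ∀ u, 0 < d u := by
      intro u; simp only [hd]; split_ifs
      · exact inv_pos.mpr hs
      · norm_num
    have hdw : ∀ x, d (w x) = 1 := by
      intro x
      have : w x ∉ Set.range a := by
        rintro ⟨c, hc⟩; exact hwa x c hc.symm
      simp only [hd, this, if_false]
    have hda : ∀ c, d (a c) = s⁻¹ := by
      intro c; simp [hd]
    have h := hz (((1 - Λ)⁻¹)ᵀ * diagonal d * (1 - Λ)⁻¹)
      ⟨Λ, diagonal d, hΛ, isDiag_diagonal d, fun u => by simpa using hdpos u, rfl⟩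
    have e := aux_cond hE w a hw ha hwa hsum hΛ d hdpos _ rfl M hM g hg
    rw [auxCond, e] at h
    have e2 : diagonal (fun x => (d (w x))⁻¹) + g * diagonal (fun c => (d (a c))⁻¹) * gᵀ
        = 1 + s • G := by
      simp only [hdw, hda, inv_inv, inv_one, diagonal_one]
      rw [← Matrix.smul_one_eq_diagonal, Matrix.mul_smul, Matrix.mul_one, Matrix.smul_mul]
    rw [e2, Matrix.mul_assoc, Matrix.mul_apply] at h
    simpa [dotProduct, Matrix.mulVec, Matrix.mul_apply] using h) n
  have : 0 < (fun x => M x y) ⬝ᵥ ((G ^ n) *ᵥ (fun x => M x y')) := by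
    refine Finset.sum_pos' (fun z _ => mul_nonneg (hM0 _ _)
      (Finset.sum_nonneg fun t _ => mul_nonneg (hn0 _ _) (hM0 _ _))) ⟨v, Finset.mem_univ _, ?_⟩
    refine mul_pos (hM1 _ _ h1) ?_
    exact Finset.sum_pos' (fun t _ => mul_nonneg (hn0 _ _) (hM0 _ _))
      ⟨v', Finset.mem_univ _, mul_pos hn1 (hM1 _ _ h2)⟩
  linarith

def auxSig (n : ℕ) (i j : Fin (n + 1)) : ℝ :=
  if (i = 0 ∧ j = Fin.last n) ∨ (i = Fin.last n ∧ j = 0) then -1 else 1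

theorem aux_triangle {n : ℕ} (hn : 3 ≤ n) (k : Fin (n + 1))
    (h0 : k ≠ 0 → cycAdj (n + 1) k 0) (h1 : k ≠ Fin.last n → cycAdj (n + 1) k (Fin.last n)) :
    k = 0 ∨ k = Fin.last n := by
  by_contra hcon
  push Not at hcon
  have h0 := h0 hcon.1
  have h1 := h1 hcon.2
  obtain ⟨k, hk⟩ := k
  simp only [cycAdj, Fin.val_zero, Fin.val_last, Nat.mod_self, ne_eq, Fin.ext_iff] at h0 h1 hcon
  rw [Nat.mod_eq_of_lt (by omega : k + 1 < n + 1), Nat.mod_eq_of_lt (by omega : 0 + 1 < n + 1)] at h0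
  rw [Nat.mod_eq_of_lt (by omega : k + 1 < n + 1)] at h1
  omega

theorem aux_nonneg {U W A : Type} [Fintype U] [DecidableEq U] [Fintype W] [Fintype A]
    [DecidableEq W] [DecidableEq A] {E : U → U → Prop} (hE : Acyclic E)
    (w : W → U) (a : A → U) (hw : Function.Injective w) (ha : Function.Injective a)
    (hwa : ∀ x y, w x ≠ a y)
    (hsum : ∀ f : U → ℝ, ∑ u, f u = ∑ x, f (w x) + ∑ y, f (a y))
    {n : ℕ} (hn : 3 ≤ n) (x : Fin (n + 1) → W)
    (hz : ∀ S ∈ DigraphCov E, ∀ i j, i ≠ j → ¬ cycAdj (n + 1) i j →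
      auxCond w a S (x i) (x j) = 0)
    (S : Matrix U U ℝ) (hS : S ∈ DigraphCov E) :
    0 ≤ ∑ i, ∑ j, auxSig n i j * auxCond w a S (x i) (x j) := by
  classical
  have hEw : Acyclic (fun x y => E (w x) (w y)) := by
    intro v hv
    exact hE (w v) (Relation.TransGen.lift w (fun _ _ h => h) _ _ hv)
  let T : W → Fin (n + 1) → Prop := fun v i => ∃ v', auxConn E w a v v' ∧ auxReach E w v' (x i)
  have hT : ∀ v i j, T v i → T v j → i ≠ j → cycAdj (n + 1) i j := by
    rintro v i j ⟨v1, c1, r1⟩ ⟨v2, c2, r2⟩ hij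
    by_contra hna
    exact aux_sep hE w a hw ha hwa hsum (x i) (x j) (fun S hS => hz S hS i j hij hna) v1 v2
      ((auxConn_symm c1).trans c2) r1 r2
  obtain ⟨Λ, Ω, hΛ, hΩ, hΩ0, hSe⟩ := hS
  obtain ⟨d, rfl⟩ : ∃ d, Ω = diagonal d := ⟨_, hΩ.diagonal_diag.symm⟩
  have hd : ∀ u, 0 < d u := fun u => by simpa using hΩ0 u
  have hΛw : SupportedOn (fun x y => E (w x) (w y)) (Λ.submatrix w w) :=
    fun u v h => hΛ _ _ h
  set M := (1 - Λ.submatrix w w)⁻¹ with hM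
  set g := M * Λ.submatrix w a with hg
  have e := aux_cond hE w a hw ha hwa hsum hΛ d hd S hSe M hM g hg
  have hMs : ∀ x y, M x y ≠ 0 → auxReach E w x y := (aux_inv hEw hΛw).2.2.1
  have hgs : ∀ x c, g x c ≠ 0 → ∃ b, auxReach E w x b ∧ E (w b) (a c) := by
    intro x c h
    rw [hg, Matrix.mul_apply] at h
    obtain ⟨b, -, hb⟩ := Finset.exists_ne_zero_of_sum_ne_zero h
    refine ⟨b, hMs _ _ (left_ne_zero_of_mul hb), ?_⟩
    by_contra hne
    exact right_ne_zero_of_mul hb (hΛ _ _ hne)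
  set Q := diagonal (fun x => (d (w x))⁻¹) + g * diagonal (fun y => (d (a y))⁻¹) * gᵀ with hQ
  have hQpd : Q.PosDef := by
    apply PosDef.add_posSemidef
    · exact PosDef.diagonal fun x => inv_pos.mpr (hd _)
    · have := (PosDef.diagonal (R := ℝ) (d := fun y => (d (a y))⁻¹)
        fun y => inv_pos.mpr (hd _)).posSemidef.mul_mul_conjTranspose_same g
      simpa using this
  have hQu : IsUnit Q.det := hQpd.det_pos.ne'.isUnit
  have hQs : ∀ x y, Q x y ≠ 0 → auxConn E w a x y := by
    intro x y h
    by_cases hxy : x = y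
    · subst hxy; exact Relation.ReflTransGen.refl
    · rw [hQ, Matrix.add_apply, Matrix.diagonal_apply_ne _ hxy, zero_add, Matrix.mul_apply] at h
      obtain ⟨c, -, hc⟩ := Finset.exists_ne_zero_of_sum_ne_zero h
      rw [Matrix.mul_diagonal] at hc
      exact Relation.ReflTransGen.single ⟨c,
        hgs _ _ (left_ne_zero_of_mul (left_ne_zero_of_mul hc)),
        hgs _ _ (right_ne_zero_of_mul hc)⟩
  have hPs : ∀ x y, Q⁻¹ x y ≠ 0 → auxConn E w a x y :=
    aux_mask Q hQu (auxConn E w a) (fun _ => Relation.ReflTransGen.refl)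
      (fun _ _ => auxConn_symm) (fun _ _ _ h1 h2 => h1.trans h2) hQs
  let ξ : W → Fin (n + 1) → ℝ := fun v i =>
    if (T v 0 ∧ T v (Fin.last n)) ∧ i = 0 then -1 else 1
  have hkey : ∀ v v' i j, auxSig n i j * (M v (x i) * (Q⁻¹ v v' * M v' (x j))) =
      (ξ v i * M v (x i)) * (Q⁻¹ v v' * (ξ v' j * M v' (x j))) := by
    intro v v' i j
    by_cases h1 : M v (x i) = 0
    · simp [h1]
    by_cases h2 : M v' (x j) = 0
    · simp [h2]
    by_cases h3 : Q⁻¹ v v' = 0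
    · simp [h3]
    have hc := hPs _ _ h3
    have hTT : T v = T v' := by
      ext k
      constructor
      · rintro ⟨u, hu, hr⟩; exact ⟨u, (auxConn_symm hc).trans hu, hr⟩
      · rintro ⟨u, hu, hr⟩; exact ⟨u, hc.trans hu, hr⟩
    have hi : T v i := ⟨v, Relation.ReflTransGen.refl, hMs _ _ h1⟩
    have hj : T v j := ⟨v', hc, hMs _ _ h2⟩
    have hs : auxSig n i j = ξ v i * ξ v' j := by
      have hl : Fin.last n ≠ 0 := by simp [Fin.ext_iff]; omega
      simp only [ξ, ← hTT, auxSig]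
      by_cases hb : T v 0 ∧ T v (Fin.last n)
      · have ti := aux_triangle hn i (hT v i 0 hi hb.1) (hT v i _ hi hb.2)
        have tj := aux_triangle hn j (hT v j 0 hj hb.1) (hT v j _ hj hb.2)
        rcases ti with rfl | rfl <;> rcases tj with rfl | rfl <;> simp [hb, hl, hl.symm]
      · rw [if_neg, if_neg (fun h => hb h.1), if_neg (fun h => hb h.1), one_mul]
        rintro (⟨rfl, rfl⟩ | ⟨rfl, rfl⟩)
        · exact hb ⟨hi, hj⟩
        · exact hb ⟨hj, hi⟩
    rw [hs]; ring
  have hpos := hQpd.inv.posSemidef.dotProduct_mulVec_nonneg (fun v => ∑ i, ξ v i * M v (x i))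
  refine le_of_le_of_eq hpos (Eq.symm ?_)
  rw [show auxCond w a S = _ from e]
  have e1 : ∀ i j, auxSig n i j * (Mᵀ * Q⁻¹ * M) (x i) (x j) =
      ∑ v, ∑ v', (ξ v i * M v (x i)) * (Q⁻¹ v v' * (ξ v' j * M v' (x j))) := by
    intro i j
    rw [Matrix.mul_assoc, Matrix.mul_apply, Finset.mul_sum]
    refine Finset.sum_congr rfl fun v _ => ?_
    rw [Matrix.mul_apply, Finset.mul_sum, Finset.mul_sum]
    refine Finset.sum_congr rfl fun v' _ => ?_
    rw [← hkey]; rfl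
  simp only [e1, dotProduct, Matrix.mulVec, Pi.star_apply, star_trivial, Finset.mul_sum,
    Finset.sum_mul]
  calc _ = ∑ i, ∑ v, ∑ v', ∑ j, (ξ v i * M v (x i)) * (Q⁻¹ v v' * (ξ v' j * M v' (x j))) := by
        refine Finset.sum_congr rfl fun i _ => ?_
        rw [Finset.sum_comm]
        refine Finset.sum_congr rfl fun v _ => ?_
        rw [Finset.sum_comm]
    _ = ∑ v, ∑ i, ∑ v', ∑ j, (ξ v i * M v (x i)) * (Q⁻¹ v v' * (ξ v' j * M v' (x j))) := by
        rw [Finset.sum_comm]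
    _ = _ := by
        refine Finset.sum_congr rfl fun v _ => ?_
        rw [Finset.sum_comm]
        refine Finset.sum_congr rfl fun v' _ => ?_
        rw [Finset.sum_comm]

theorem auxSig_self {n : ℕ} (hn : 3 ≤ n) (i : Fin (n + 1)) : auxSig n i i = 1 := by
  rw [auxSig, if_neg]
  simp only [Fin.ext_iff, Fin.val_zero, Fin.val_last]
  omega

theorem auxSig_symm {n : ℕ} (i j : Fin (n + 1)) : auxSig n i j = auxSig n j i := by
  simp only [auxSig]
  congr 1
  apply propext
  tauto

theorem auxSig_sq {n : ℕ} (i j : Fin (n + 1)) : auxSig n i j * auxSig n i j = 1 := by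
  simp only [auxSig]; split_ifs <;> norm_num

theorem auxSig_last {n : ℕ} : auxSig n (Fin.last n) (Fin.last n + 1) = -1 := by
  simp [auxSig]

theorem auxSig_succ {n : ℕ} (hn : 3 ≤ n) (k : Fin (n + 1)) (hk : k ≠ Fin.last n) :
    auxSig n k (k + 1) = 1 := by
  have hk' : k.val < n := by
    have := k.2
    have h : k.val ≠ n := fun h => hk (Fin.ext h)
    omega
  have h1 : (k + 1).val = k.val + 1 := Fin.val_add_one_of_lt (by simpa [Fin.lt_def] using hk')
  rw [auxSig, if_neg]
  simp only [Fin.ext_iff, Fin.val_zero, Fin.val_last, h1]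
  omega

noncomputable def auxD (n : ℕ) : Matrix (Fin (n + 1)) (Fin (n + 1)) ℝ :=
  Matrix.of fun k i => (if i = k then 1 else 0) - (if i = k + 1 then auxSig n k (k + 1) else 0)

theorem auxD_sum {n : ℕ} (k : Fin (n + 1)) (f : Fin (n + 1) → ℝ) :
    ∑ i, auxD n k i * f i = f k - auxSig n k (k + 1) * f (k + 1) := by
  simp [auxD, sub_mul, Finset.sum_sub_distrib]

noncomputable def auxPhi (n : ℕ) : Matrix (Fin (n + 1)) (Fin (n + 1)) ℝ :=
  (1 / 2 : ℝ) • ((auxD n)ᵀ * auxD n) - Matrix.single 0 0 (1 / ((n : ℝ) + 1))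

theorem auxPhi_supp {n : ℕ} (i j : Fin (n + 1)) (hij : i ≠ j)
    (h : ¬ cycAdj (n + 1) i j) : auxPhi n i j = 0 := by
  have h1 : Matrix.single (0 : Fin (n + 1)) (0 : Fin (n + 1)) (1 / ((n : ℝ) + 1)) i j = 0 := by
    rw [Matrix.single_apply, if_neg]
    rintro ⟨rfl, rfl⟩; exact hij rfl
  have hadj : ∀ k : Fin (n + 1), (k.val + 1) % (n + 1) = (k + 1).val := by
    intro k
    rw [Fin.val_add, Fin.val_one', Nat.add_mod_mod]
  rw [auxPhi, Matrix.sub_apply, h1, sub_zero, Matrix.smul_apply, Matrix.mul_apply]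
  simp only [smul_eq_mul, Matrix.transpose_apply]
  rw [Finset.sum_eq_zero, mul_zero]
  intro k _
  simp only [auxD, Matrix.of_apply]
  by_cases hi : i = k
  · subst hi
    have : j ≠ i + 1 := by
      rintro rfl; exact h (Or.inl (hadj i))
    simp [this, hij.symm]
  · by_cases hi' : i = k + 1
    · subst hi'
      have : j ≠ k := by
        rintro rfl; exact h (Or.inr (hadj j))
      simp [this, hij.symm]
    · simp [hi, hi']

theorem auxPhi_neg {n : ℕ} (hn : 3 ≤ n) : ∑ i, ∑ j, auxSig n i j * auxPhi n i j < 0 := by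
  have h1 : ∑ i, ∑ j, auxSig n i j * auxPhi n i j =
      (1 / 2) * ∑ k, ∑ i, auxD n k i * ∑ j, auxD n k j * auxSig n i j - 1 / ((n : ℝ) + 1) := by
    simp only [auxPhi, Matrix.sub_apply, mul_sub, Finset.sum_sub_distrib]
    congr 1
    · simp only [Matrix.smul_apply, Matrix.mul_apply, smul_eq_mul, Matrix.transpose_apply,
        Finset.mul_sum]
      rw [Finset.sum_comm]
      calc _ = ∑ j, ∑ k, ∑ i, auxSig n i j * (1 / 2 * (auxD n k i * auxD n k j)) := by
            refine Finset.sum_congr rfl fun j _ => ?_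
            rw [Finset.sum_comm]
        _ = ∑ k, ∑ j, ∑ i, auxSig n i j * (1 / 2 * (auxD n k i * auxD n k j)) := by
            rw [Finset.sum_comm]
        _ = _ := by
            refine Finset.sum_congr rfl fun k _ => ?_
            rw [Finset.sum_comm]
            refine Finset.sum_congr rfl fun i _ => Finset.sum_congr rfl fun j _ => ?_
            ring
    · simp only [Matrix.single_apply]
      rw [Finset.sum_eq_single 0, Finset.sum_eq_single 0]
      · simp [auxSig_self hn]
      · intro j _ hj; simp [hj.symm]
      · simp
      · intro i _ hi; simp [hi.symm]
      · simp
  have h2 : ∀ k : Fin (n + 1), ∑ i, auxD n k i * ∑ j, auxD n k j * auxSig n i j = 0 := by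
    intro k
    rw [auxD_sum, auxD_sum, auxD_sum, auxSig_self hn, auxSig_self hn, auxSig_symm (k + 1) k]
    have := auxSig_sq k (k + 1)
    linear_combination (-1 : ℝ) * this
  rw [h1]
  simp only [h2, Finset.sum_const_zero, mul_zero, zero_sub]
  have : 0 < 1 / ((n : ℝ) + 1) := by positivity
  linarith

theorem auxPhi_posDef {n : ℕ} (hn : 3 ≤ n) : (auxPhi n).PosDef := by
  apply PosDef.of_dotProduct_mulVec_pos
  · rw [Matrix.IsHermitian, Matrix.conjTranspose_eq_transpose_of_trivial, auxPhi]
    simp [Matrix.transpose_mul]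
  · intro y hy
    set z := auxD n *ᵥ y with hz
    have hzk : ∀ k, z k = y k - auxSig n k (k + 1) * y (k + 1) := fun k => auxD_sum k y
    have e : star y ⬝ᵥ auxPhi n *ᵥ y = (1 / 2) * ∑ k, z k ^ 2 - (1 / ((n : ℝ) + 1)) * y 0 ^ 2 := by
      have e1 : y ⬝ᵥ (((auxD n)ᵀ * auxD n) *ᵥ y) = ∑ k, z k ^ 2 := by
        rw [← Matrix.mulVec_mulVec, Matrix.dotProduct_mulVec, Matrix.vecMul_transpose, ← hz]
        simp [dotProduct, sq]
      have e2 : y ⬝ᵥ ((Matrix.single (0 : Fin (n + 1)) (0 : Fin (n + 1)) (1 / ((n : ℝ) + 1))) *ᵥ y)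
          = (1 / ((n : ℝ) + 1)) * y 0 ^ 2 := by
        rw [Matrix.single_mulVec]
        simp [dotProduct, Function.update_apply]
        ring
      rw [star_trivial, auxPhi, Matrix.sub_mulVec, Matrix.smul_mulVec, dotProduct_sub,
        dotProduct_smul, e1, e2, smul_eq_mul]
    rw [e]
    have hs : ∑ k, z k = 2 * y 0 := by
      have s1 : ∑ k : Fin (n + 1), y (k + 1) = ∑ k, y k :=
        Equiv.sum_comp (Equiv.addRight (1 : Fin (n + 1))) y
      have s2 : ∑ k : Fin (n + 1), (auxSig n k (k + 1) - 1) * y (k + 1) = -2 * y 0 := by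
        rw [Finset.sum_eq_single (Fin.last n)]
        · rw [auxSig_last, Fin.last_add_one]; ring
        · intro k _ hk; rw [auxSig_succ hn k hk]; ring
        · simp
      have s3 : ∑ k, z k = ∑ k, y k - ∑ k : Fin (n + 1), y (k + 1)
          - ∑ k : Fin (n + 1), (auxSig n k (k + 1) - 1) * y (k + 1) := by
        rw [← Finset.sum_sub_distrib, ← Finset.sum_sub_distrib]
        refine Finset.sum_congr rfl fun k _ => ?_
        rw [hzk]; ring
      rw [s3, s1, s2]; ring
    have hcs : (∑ k, z k) ^ 2 ≤ ((n : ℝ) + 1) * ∑ k, z k ^ 2 := by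
      have := sq_sum_le_card_mul_sum_sq (s := Finset.univ) (f := z)
      simpa using this
    rw [hs] at hcs
    have hN : (0 : ℝ) < (n : ℝ) + 1 := by positivity
    have hb : (1 / ((n : ℝ) + 1)) * y 0 ^ 2 ≤ (1 / 4) * ∑ k, z k ^ 2 := by
      rw [one_div, inv_mul_le_iff₀ hN]
      nlinarith
    have hnn : 0 ≤ ∑ k, z k ^ 2 := Finset.sum_nonneg fun k _ => sq_nonneg _
    rcases hnn.lt_or_eq with hpos | h0
    · linarith
    · exfalso
      apply hy
      have hz0 : ∀ k, z k = 0 := by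
        intro k
        have := (Finset.sum_eq_zero_iff_of_nonneg (fun k _ => sq_nonneg (z k))).mp h0.symm k
          (Finset.mem_univ _)
        exact pow_eq_zero_iff (two_ne_zero) |>.mp this
      have hy0 : y 0 = 0 := by
        simp only [hz0, Finset.sum_const_zero] at hs
        linarith
      have hstep : ∀ k, y k = 0 → y (k + 1) = 0 := by
        intro k hk
        have h := hzk k
        rw [hz0, hk] at h
        have h2 := auxSig_sq k (k + 1)
        have h3 : auxSig n k (k + 1) ≠ 0 := by
          intro h; rw [h] at h2; norm_num at h2
        have : auxSig n k (k + 1) * y (k + 1) = 0 := by linarith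
        exact (mul_eq_zero.mp this).resolve_left h3
      ext k
      induction k using Fin.induction with
      | zero => exact hy0
      | succ i ih =>
        have := hstep _ ih
        rwa [Fin.coeSucc_eq_succ] at this

theorem aux_mem {V U : Type} [Fintype V] [DecidableEq V] [Fintype U] [DecidableEq U]
    (E : U → U → Prop) (ι : V ↪ U) (A : Set V) [Fintype ↥A] [DecidableEq ↥A] {p : ℕ}
    (cyc : Fin p ↪ V) {W : Type} (w : W → U) (x : Fin p → W) (hx : ∀ i, w (x i) = ι (cyc i))
    (Φ : Matrix (Fin p) (Fin p) ℝ) :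
    Φ ∈ condCovSet E ι A p cyc ↔ ∃ S ∈ DigraphCov E, ∀ i j,
      Φ i j = auxCond w (fun y : ↥A => ι y.1) S (x i) (x j) := by
  classical
  rw [condCovSet, Set.mem_ofPred_eq]
  have key : ∀ (S : Matrix U U ℝ) (i j : Fin p),
      auxCond w (fun y : ↥A => ι y.1) S (x i) (x j) = S (ι (cyc i)) (ι (cyc j)) -
        ∑ a : ↥A, ∑ b : ↥A,
          S (ι (cyc i)) (ι a.1) *
            (Matrix.of fun a b : ↥A => S (ι a.1) (ι b.1))⁻¹ a b * S (ι b.1) (ι (cyc j)) := by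
    intro S i j
    rw [auxCond, Matrix.sub_apply, Matrix.submatrix_apply, hx, hx, Matrix.mul_apply]
    simp only [Matrix.mul_apply, Finset.sum_mul, Matrix.submatrix_apply, hx]
    rw [Finset.sum_comm]
    rfl
  simp only [key]
  congr!

theorem aux_core {V U : Type} [Fintype V] [DecidableEq V] [Fintype U] [DecidableEq U]
    (E : U → U → Prop) (hE : Acyclic E) (ι : V ↪ U) (A : Set V) {n : ℕ} (hn : 3 ≤ n)
    (cyc : Fin (n + 1) ↪ V) (hcyc : ∀ i, cyc i ∉ A)
    (hz : ∀ Φ ∈ condCovSet E ι A (n + 1) cyc, ∀ i j, i ≠ j → ¬ cycAdj (n + 1) i j → Φ i j = 0)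
    (hm : auxPhi n ∈ condCovSet E ι A (n + 1) cyc) : False := by
  classical
  let w : {u // u ∉ ι '' A} → U := Subtype.val
  let a : ↥A → U := fun y => ι y.1
  let x : Fin (n + 1) → {u // u ∉ ι '' A} := fun i => ⟨ι (cyc i), by
    rintro ⟨v, hv, he⟩
    exact hcyc i (ι.injective he ▸ hv)⟩
  have hmem := aux_mem E ι A cyc w x (fun i => rfl)
  have hsum : ∀ f : U → ℝ, ∑ u, f u = ∑ x, f (w x) + ∑ y, f (a y) := by
    intro f
    rw [← Fintype.sum_subtype_add_sum_subtype (fun u => u ∈ ι '' A) f, add_comm]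
    congr 1
    convert (Fintype.sum_equiv (Equiv.Set.image ι A ι.injective) (fun y => f (a y))
      (fun u => f u.1) (fun y => rfl)).symm
  have hzz : ∀ S ∈ DigraphCov E, ∀ i j, i ≠ j → ¬ cycAdj (n + 1) i j →
      auxCond w a S (x i) (x j) = 0 := by
    intro S hS i j hij hna
    exact hz (Matrix.of fun i j => auxCond w a S (x i) (x j))
      ((hmem _).mpr ⟨S, hS, fun i j => rfl⟩) i j hij hna
  obtain ⟨S, hS, hΦ⟩ := (hmem _).mp hm
  have h1 := aux_nonneg hE w a Subtype.val_injective
    (fun y y' h => Subtype.ext (ι.injective h))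
    (fun x y h => x.2 ⟨y.1, y.2, h.symm⟩) hsum hn x hzz S hS
  have h2 := auxPhi_neg hn
  simp only [hΦ] at h2
  exact absurd h1 (not_le.mpr h2)

theorem aux_chain_acyclic {V : Type} {D : V → V → Prop} {B : SimpleGraph V}
    (hCG : ChainGraph D B) : Acyclic D := by
  intro v hv
  obtain ⟨u, h1, h2⟩ := Relation.TransGen.head'_iff.mp hv
  exact hCG ⟨v, u, h1, Relation.ReflTransGen.mono (fun _ _ h => Or.inl h) _ _ h2⟩

theorem aux_reach {V : Type} {D : V → V → Prop} {B : SimpleGraph V} {u v : V}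
    (h : B.Reachable u v) : Relation.ReflTransGen (fun a b => D a b ∨ B.Adj a b) u v := by
  rw [SimpleGraph.reachable_iff_reflTransGen] at h
  exact Relation.ReflTransGen.mono (fun _ _ h => Or.inr h) _ _ h

theorem aux_chain {V : Type} [Fintype V] [DecidableEq V] {D : V → V → Prop}
    {B : SimpleGraph V} (hCG : ChainGraph D B) (Λ Ω S : Matrix V V ℝ)
    (hΛ : SupportedOn D Λ) (hΩ : Ω.PosDef) (hB : BSupported B Ω)
    (hS : S = ((1 - Λ)⁻¹)ᵀ * Ω * (1 - Λ)⁻¹) (c : V) (A : Set V) (hA : A = ancSet D B c)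
    [Fintype ↥A] [DecidableEq ↥A] (i j : V) (hi : B.Reachable c i) (hj : B.Reachable c j) :
    S i j - ∑ a : ↥A, ∑ b : ↥A,
      S i a.1 * (Matrix.of fun a b : ↥A => S a.1 b.1)⁻¹ a b * S b.1 j = Ω i j := by
  have hD := aux_chain_acyclic hCG
  obtain ⟨i1, i2, i3, -⟩ := aux_inv hD hΛ
  have hpd : S.PosDef := by rw [hS]; exact aux_posdef hD hΛ hΩ
  -- no directed edge from the component into an ancestor of the component
  have noback : ∀ u v k, B.Reachable c u → D u v → Relation.ReflTransGen D v k →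
      B.Reachable c k → False := by
    intro u v k hu huv hvk hk
    refine hCG ⟨u, v, huv, ?_⟩
    exact (Relation.ReflTransGen.mono (fun _ _ h => Or.inl h) _ _ hvk).trans
      (aux_reach (hk.symm.trans hu))
  have reachA : ∀ v k, B.Reachable c k → Relation.ReflTransGen D v k → v ∉ A → v = k := by
    intro v k hk hvk hvA
    have hv : B.Reachable c v := by
      by_contra hnv
      exact hvA (hA ▸ ⟨hnv, k, hk, hvk⟩)
    rcases Relation.ReflTransGen.cases_head hvk with h | ⟨z, h1, h2⟩
    · exact h
    · exact (noback v z k hv h1 h2 hk).elim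
  have closedA : ∀ v u, u ∈ A → Relation.ReflTransGen D v u → v ∈ A := by
    intro v u hu hvu
    rw [hA] at hu
    obtain ⟨hnu, k, hk, huk⟩ := hu
    by_contra hvA
    have := reachA v k hk (hvu.trans huk) hvA
    subst this
    rcases Relation.ReflTransGen.cases_head hvu with h | ⟨z, h1, h2⟩
    · exact hnu (h ▸ hk)
    · exact noback v z v hk h1 (h2.trans huk) hk
  have hΩA : ∀ v ∈ A, Ω v j = 0 := by
    intro v hv
    rw [hA] at hv
    apply hB
    · rintro rfl; exact hv.1 hj
    · intro hadj
      exact hv.1 (hj.trans hadj.symm.reachable)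
  have hSL : S * (1 - Λ) = ((1 - Λ)⁻¹)ᵀ * Ω := by
    rw [hS, Matrix.mul_assoc, i2, Matrix.mul_one]
  have hcol : ∀ u, S u j - ∑ a : ↥A, S u a.1 * Λ a.1 j = ∑ v, (1 - Λ)⁻¹ v u * Ω v j := by
    intro u
    have h := congrFun (congrFun hSL u) j
    rw [Matrix.mul_sub, Matrix.mul_one, Matrix.sub_apply, Matrix.mul_apply, Matrix.mul_apply] at h
    simp only [Matrix.transpose_apply] at h
    rw [← h]
    congr 1
    refine Fintype.sum_of_injective (Subtype.val : ↥A → V) Subtype.val_injective _ _ ?_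
      (fun _ => rfl)
    intro v hv
    have hvA : v ∉ A := fun h => hv ⟨⟨v, h⟩, rfl⟩
    have : ¬ D v j := by
      intro hd
      have := reachA v j hj (Relation.ReflTransGen.single hd) hvA
      subst this
      exact noback v v v hj hd Relation.ReflTransGen.refl hj
    rw [hΛ _ _ this, mul_zero]
  have hcolA : ∀ u ∈ A, S u j = ∑ a : ↥A, S u a.1 * Λ a.1 j := by
    intro u hu
    have h := hcol u
    have h0 : ∑ v, (1 - Λ)⁻¹ v u * Ω v j = 0 := by
      refine Finset.sum_eq_zero fun v _ => ?_
      by_cases hv : (1 - Λ)⁻¹ v u = 0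
      · rw [hv, zero_mul]
      · rw [hΩA v (closedA v u hu (i3 _ _ hv)), mul_zero]
    linarith
  have hNii : (1 - Λ)⁻¹ i i = 1 := by
    have h := congrFun (congrFun i1 i) i
    rw [Matrix.sub_mul, Matrix.one_mul, Matrix.sub_apply, Matrix.one_apply_eq, Matrix.mul_apply,
      Finset.sum_eq_zero, sub_zero] at h
    · exact h
    · intro v _
      by_cases hd : D i v
      · by_cases hv : (1 - Λ)⁻¹ v i = 0
        · rw [hv, mul_zero]
        · exact (noback i v i hi hd (i3 _ _ hv) hi).elim
      · rw [hΛ _ _ hd, zero_mul]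
  have hcolC : S i j - ∑ a : ↥A, S i a.1 * Λ a.1 j = Ω i j := by
    rw [hcol i, Finset.sum_eq_single i, hNii, one_mul]
    · intro v _ hvi
      by_cases hv : (1 - Λ)⁻¹ v i = 0
      · rw [hv, zero_mul]
      · by_cases hvA : v ∈ A
        · rw [hΩA v hvA, mul_zero]
        · exact (hvi (reachA v i hi (i3 _ _ hv) hvA)).elim
    · simp
  rw [← hcolC]
  congr 1
  refine Finset.sum_congr rfl fun a _ => ?_
  set T : Matrix ↥A ↥A ℝ := Matrix.of fun a b : ↥A => S a.1 b.1 with hT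
  have hTpd : T.PosDef := hpd.submatrix (e := (Subtype.val : ↥A → V)) Subtype.val_injective
  have hTu : IsUnit T.det := hTpd.det_pos.ne'.isUnit
  have h1 : (fun b : ↥A => S b.1 j) = T *ᵥ (fun a : ↥A => Λ a.1 j) := by
    ext b
    exact hcolA b.1 b.2
  have h2 : (T⁻¹ *ᵥ (fun b : ↥A => S b.1 j)) a = Λ a.1 j := by
    rw [h1, Matrix.mulVec_mulVec, Matrix.nonsing_inv_mul _ hTu, Matrix.one_mulVec]
  rw [← h2]
  simp only [Matrix.mulVec, dotProduct, Finset.mul_sum, mul_assoc]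

theorem aux_extend {V : Type} [Fintype V] [DecidableEq V] (B : SimpleGraph V) {p : ℕ}
    (cyc : Fin p ↪ V)
    (hadj : ∀ i j : Fin p, i ≠ j → (B.Adj (cyc i) (cyc j) ↔ cycAdj p i j))
    (Φ : Matrix (Fin p) (Fin p) ℝ) (hΦ : Φ.PosDef)
    (hs : ∀ i j, i ≠ j → ¬ cycAdj p i j → Φ i j = 0) :
    ∃ Ω : Matrix V V ℝ, Ω.PosDef ∧ BSupported B Ω ∧ ∀ i j, Ω (cyc i) (cyc j) = Φ i j := by
  classical
  let F : Matrix (Fin p) V ℝ := Matrix.of fun i v => if cyc i = v then 1 else 0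
  let e : V → ℝ := fun v => if v ∈ Set.range cyc then 0 else 1
  have he : ∀ i, e (cyc i) = 0 := fun i => by simp [e]
  have happ : ∀ u v, (Fᵀ * Φ * F + diagonal e) u v =
      (∑ j, ∑ i, (if cyc i = u then 1 else 0) * Φ i j * (if cyc j = v then 1 else 0))
        + diagonal e u v := by
    intro u v
    rw [Matrix.add_apply, Matrix.mul_apply]
    congr 1
    refine Finset.sum_congr rfl fun j _ => ?_
    rw [Matrix.mul_apply, Finset.sum_mul]
    rfl
  refine ⟨Fᵀ * Φ * F + diagonal e, ?_, ?_, ?_⟩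
  · apply PosDef.of_dotProduct_mulVec_pos
    · rw [Matrix.IsHermitian, Matrix.conjTranspose_eq_transpose_of_trivial]
      have hsym : Φᵀ = Φ := by
        have := hΦ.1
        rwa [Matrix.IsHermitian, Matrix.conjTranspose_eq_transpose_of_trivial] at this
      simp [Matrix.transpose_mul, hsym, Matrix.mul_assoc]
    · intro x hx
      have hF : F *ᵥ x = fun i => x (cyc i) := by
        ext i; simp [F, Matrix.mulVec, dotProduct]
      have h1 : star x ⬝ᵥ (Fᵀ * Φ * F + diagonal e) *ᵥ x =
          (F *ᵥ x) ⬝ᵥ (Φ *ᵥ (F *ᵥ x)) + ∑ v, e v * x v ^ 2 := by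
        rw [star_trivial, Matrix.add_mulVec, dotProduct_add, ← Matrix.mulVec_mulVec,
          ← Matrix.mulVec_mulVec, Matrix.dotProduct_mulVec x, Matrix.vecMul_transpose]
        congr 1
        simp only [dotProduct, Matrix.mulVec_diagonal]
        exact Finset.sum_congr rfl fun v _ => by ring
      have he0 : ∀ v, 0 ≤ e v := fun v => by simp only [e]; split_ifs <;> norm_num
      have h2 : 0 ≤ ∑ v, e v * x v ^ 2 :=
        Finset.sum_nonneg fun v _ => mul_nonneg (he0 v) (sq_nonneg _)
      rw [h1]
      by_cases hz : F *ᵥ x = 0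
      · rw [hz, zero_dotProduct, zero_add]
        obtain ⟨v, hv⟩ := Function.ne_iff.mp hx
        refine Finset.sum_pos' (fun v _ => mul_nonneg (he0 v) (sq_nonneg _))
          ⟨v, Finset.mem_univ _, ?_⟩
        have hvr : v ∉ Set.range cyc := by
          rintro ⟨i, rfl⟩
          exact hv (by simpa [hF] using congrFun hz i)
        have : e v = 1 := if_neg hvr
        rw [this, one_mul]
        exact sq_pos_of_ne_zero hv
      · have := hΦ.dotProduct_mulVec_pos hz
        rw [star_trivial] at this
        linarith
  · intro u v huv hna
    rw [happ, Matrix.diagonal_apply_ne _ huv, add_zero]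
    refine Finset.sum_eq_zero fun j _ => Finset.sum_eq_zero fun i _ => ?_
    by_cases hi : cyc i = u
    · by_cases hj : cyc j = v
      · subst hi hj
        have hij : i ≠ j := fun h => huv (by rw [h])
        rw [hs i j hij (fun h => hna ((hadj i j hij).mpr h))]
        simp
      · simp [hj]
    · simp [hi]
  · intro i j
    rw [happ]
    have hd : diagonal e (cyc i) (cyc j) = 0 := by
      rw [Matrix.diagonal_apply]; split_ifs
      · exact he i
      · rfl
    rw [hd]
    simp

end Helpers

theorem stmt16 {V : Type} [Fintype V] [DecidableEq V] (D : V → V → Prop)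
    (B : SimpleGraph V) (hCG : ChainGraph D B)
    {p : ℕ} (hp : 4 ≤ p) (cyc : Fin p ↪ V)
    (hadj : ∀ i j : Fin p, i ≠ j → (B.Adj (cyc i) (cyc j) ↔ cycAdj p i j)) :
    (¬ ∃ (U : Type) (iF : Fintype U) (iD : DecidableEq U) (ι : V ↪ U)
        (E : U → U → Prop), Acyclic E ∧
        @condCovSet V U _ _ iF iD E ι (ancSet D B (cyc ⟨0, by omega⟩)) p cyc =
          {Φ : Matrix (Fin p) (Fin p) ℝ | Φ.PosDef ∧
            ∀ i j : Fin p, i ≠ j → ¬ cycAdj p i j → Φ i j = 0}) ∧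
    ¬ StrictlyGaussianCausal D B := by
  classical
  obtain ⟨n, rfl⟩ : ∃ n, p = n + 1 := ⟨p - 1, by omega⟩
  have hn : 3 ≤ n := by omega
  have h0 : (⟨0, by omega⟩ : Fin (n + 1)) = 0 := rfl
  rw [h0]
  have hreach : ∀ k, B.Reachable (cyc 0) (cyc k) := by
    intro k
    induction k using Fin.induction with
    | zero => exact SimpleGraph.Reachable.refl _
    | succ i ih =>
      refine ih.trans (SimpleGraph.Adj.reachable ?_)
      refine (hadj _ _ ?_).mpr (Or.inl ?_)
      · simp [Fin.ext_iff]
      · simp only [Fin.val_castSucc, Fin.val_succ]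
        exact Nat.mod_eq_of_lt (by omega)
  have hcyc : ∀ i, cyc i ∉ ancSet D B (cyc 0) := fun i h => h.1 (hreach i)
  constructor
  · rintro ⟨U, iF, iD, ι, E, hE, heq⟩
    refine aux_core E hE ι _ hn cyc hcyc ?_ ?_
    · intro Φ hΦ
      rw [heq] at hΦ
      exact hΦ.2
    · rw [heq]
      exact ⟨auxPhi_posDef hn, auxPhi_supp⟩
  · rintro ⟨U, iF, iD, ι, E, hE, himg⟩
    refine aux_core E hE ι _ hn cyc hcyc ?_ ?_
    · rintro Φ ⟨S, hS, hΦ⟩ i j hij hna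
      have hmem : S.submatrix ι ι ∈ MixedCov D B := himg ▸ ⟨S, hS, rfl⟩
      obtain ⟨Λ, Ω, hΛ, hΩ, hB, hSe⟩ := hmem
      refine ((hΦ i j).trans (aux_chain hCG Λ Ω (S.submatrix ι ι) hΛ hΩ hB hSe (cyc 0) _ rfl
        (cyc i) (cyc j) (hreach i) (hreach j))).trans ?_
      refine hB _ _ (fun h => hij (cyc.injective h)) ?_
      rwa [hadj i j hij]
    · obtain ⟨Ω, hΩ, hB, hΩc⟩ := aux_extend B cyc hadj (auxPhi n) (auxPhi_posDef hn) auxPhi_supp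
      have hmem : Ω ∈ MixedCov D B := ⟨0, Ω, fun _ _ _ => rfl, hΩ, hB, by simp⟩
      rw [← himg] at hmem
      obtain ⟨S, hS, hSe⟩ := hmem
      have hSe : S.submatrix ι ι = Ω := hSe
      refine ⟨S, hS, fun i j => ?_⟩
      rw [← hΩc]
      exact (aux_chain hCG 0 Ω (S.submatrix ι ι) (fun _ _ _ => rfl) hΩ hB (by simp [hSe]) (cyc 0) _
        rfl (cyc i) (cyc j) (hreach i) (hreach j)).symm
end

section
/- Main theorem for chain graphs: a chain graph G = (V,D,B) is strictly Gaussian causal if and only if its bidirected part (V,B) is decomposable (chordal). -/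
open Matrix BigOperators

section Part1

lemma wf_of_acyclic {U : Type} [Finite U] {E : U → U → Prop} (h : Acyclic E) : WellFounded E := by
  have : IsTrans U (Relation.TransGen E) := ⟨fun _ _ _ => Relation.TransGen.trans⟩
  have : Std.Irrefl (Relation.TransGen E) := ⟨h⟩
  have := Finite.wellFounded_of_trans_of_irrefl (Relation.TransGen E)
  exact Subrelation.wf (fun {a b} hab => Relation.TransGen.single hab) this

lemma det_one_sub {U : Type} [Fintype U] [DecidableEq U] {E : U → U → Prop} (h : WellFounded E)
    {Λ : Matrix U U ℝ} (hΛ : SupportedOn E Λ) : IsUnit (1 - Λ).det := by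
  rw [isUnit_iff_ne_zero]
  intro h0
  obtain ⟨x, hx, hx0⟩ := Matrix.exists_vecMul_eq_zero_iff.2 h0
  apply hx
  funext w
  induction w using h.induction with
  | _ w ih =>
    have := congrFun hx0 w
    rw [Matrix.vecMul_sub, Matrix.vecMul_one, Pi.sub_apply, Pi.zero_apply, sub_eq_zero] at this
    rw [this, Pi.zero_apply, Matrix.vecMul, dotProduct]
    apply Finset.sum_eq_zero
    intro a _
    by_cases ha : E a w
    · rw [ih a ha]; simp
    · rw [hΛ a w ha]; simp

lemma T_rec {U : Type} [Fintype U] [DecidableEq U] {Λ : Matrix U U ℝ} (h : IsUnit (1 - Λ).det)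
    (v w : U) : (1 - Λ)⁻¹ v w = (1 : Matrix U U ℝ) v w + ∑ a, (1 - Λ)⁻¹ v a * Λ a w := by
  have h1 := Matrix.nonsing_inv_mul _ h
  rw [mul_sub, mul_one, sub_eq_iff_eq_add] at h1
  have := congrFun (congrFun h1 v) w
  rwa [Matrix.add_apply, Matrix.mul_apply] at this

lemma T_supp {U : Type} [Fintype U] [DecidableEq U] {E : U → U → Prop} (h : WellFounded E)
    {Λ : Matrix U U ℝ} (hΛ : SupportedOn E Λ) (v w : U) (hvw : ¬ Relation.ReflTransGen E v w) :
    (1 - Λ)⁻¹ v w = 0 := by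
  induction w using h.induction with
  | _ w ih =>
    rw [T_rec (det_one_sub h hΛ)]
    have hne : v ≠ w := by rintro rfl; exact hvw .refl
    rw [Matrix.one_apply_ne hne, zero_add]
    apply Finset.sum_eq_zero
    intro a _
    by_cases ha : E a w
    · rw [ih a ha (fun h' => hvw (h'.tail ha))]; simp
    · rw [hΛ a w ha]; simp

lemma T_nonneg {U : Type} [Fintype U] [DecidableEq U] {E : U → U → Prop} (h : WellFounded E)
    {Λ : Matrix U U ℝ} (hΛ : SupportedOn E Λ) (h0 : ∀ a b, 0 ≤ Λ a b) (v w : U) :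
    0 ≤ (1 - Λ)⁻¹ v w := by
  induction w using h.induction with
  | _ w ih =>
    rw [T_rec (det_one_sub h hΛ)]
    apply add_nonneg
    · rw [Matrix.one_apply]; split_ifs <;> norm_num
    apply Finset.sum_nonneg
    intro a _
    by_cases ha : E a w
    · exact mul_nonneg (ih a ha) (h0 _ _)
    · rw [hΛ a w ha]; simp

lemma T_pos {U : Type} [Fintype U] [DecidableEq U] {E : U → U → Prop} (h : WellFounded E)
    {Λ : Matrix U U ℝ} (hΛ : SupportedOn E Λ) (h0 : ∀ a b, 0 ≤ Λ a b)
    (h1 : ∀ a b, E a b → 0 < Λ a b) (v w : U) (hvw : Relation.ReflTransGen E v w) :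
    0 < (1 - Λ)⁻¹ v w := by
  induction hvw with
  | refl =>
    rw [T_rec (det_one_sub h hΛ), Matrix.one_apply_eq]
    have : 0 ≤ ∑ a, (1 - Λ)⁻¹ v a * Λ a v :=
      Finset.sum_nonneg fun a _ => mul_nonneg (T_nonneg h hΛ h0 _ _) (h0 _ _)
    linarith
  | @tail b c hb hbc ih =>
    rw [T_rec (det_one_sub h hΛ)]
    have h2 : (1 - Λ)⁻¹ v b * Λ b c ≤ ∑ a, (1 - Λ)⁻¹ v a * Λ a c :=
      Finset.single_le_sum (f := fun a => (1 - Λ)⁻¹ v a * Λ a c)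
        (fun a _ => mul_nonneg (T_nonneg h hΛ h0 _ _) (h0 _ _)) (Finset.mem_univ b)
    have h3 : 0 < (1 - Λ)⁻¹ v b * Λ b c := mul_pos ih (h1 _ _ hbc)
    have h4 : (0:ℝ) ≤ (1 : Matrix U U ℝ) v c := by
      rw [Matrix.one_apply]; split_ifs <;> norm_num
    linarith

/-- entries of a covariance matrix with diagonal error matrix -/
lemma cov_entry {U : Type} [Fintype U] [DecidableEq U] {Ω : Matrix U U ℝ} (hΩ : Ω.IsDiag)
    (T : Matrix U U ℝ) (a b : U) : (Tᵀ * Ω * T) a b = ∑ u, Ω u u * T u a * T u b := by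
  rw [Matrix.mul_apply]
  apply Finset.sum_congr rfl
  intro u _
  rw [Matrix.mul_apply, Finset.sum_eq_single u]
  · rw [Matrix.transpose_apply]; ring
  · intro b _ hb; rw [hΩ hb, mul_zero]
  · simp

/-- Minimal chains. -/
lemma exists_min_chain {X : Type} (r : X → X → Prop) (A C : X → Prop)
    (h : ∃ x y, A x ∧ Relation.ReflTransGen r x y ∧ C y) :
    ∃ (m : ℕ) (u : ℕ → X), A (u 0) ∧ C (u m) ∧ (∀ k < m, r (u k) (u (k + 1))) ∧
      (∀ k ≤ m, A (u k) → k = 0) ∧ (∀ k ≤ m, C (u k) → k = m) ∧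
      (∀ k l, k < l → l ≤ m → r (u k) (u l) → l = k + 1) := by
  classical
  have hex : ∃ m : ℕ, ∃ u : ℕ → X, A (u 0) ∧ C (u m) ∧ (∀ k < m, r (u k) (u (k + 1))) := by
    obtain ⟨x, y, hx, hxy, hy⟩ := h
    suffices ∃ m : ℕ, ∃ u : ℕ → X, u 0 = x ∧ u m = y ∧ (∀ k < m, r (u k) (u (k + 1))) by
      obtain ⟨m, u, h0, h1, h2⟩ := this
      exact ⟨m, u, h0 ▸ hx, h1 ▸ hy, h2⟩
    clear hy
    induction hxy with
    | refl => exact ⟨0, fun _ => x, rfl, rfl, by simp⟩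
    | @tail b c hb hbc ih =>
      obtain ⟨m, u, h0, h1, h2⟩ := ih
      refine ⟨m + 1, fun k => if k ≤ m then u k else c, by simp [h0], by simp, ?_⟩
      intro k hk
      rcases Nat.lt_succ_iff_lt_or_eq.1 hk with h | h
      · simp only [h.le, if_true, Nat.succ_le_of_lt h]; exact h2 k h
      · subst h; simpa [h1] using hbc
  obtain ⟨u, h0, h1, h2⟩ := Nat.find_spec hex
  have hmin := fun k => @Nat.find_min _ _ hex k
  set m := Nat.find hex
  refine ⟨m, u, h0, h1, h2, ?_, ?_, ?_⟩
  · intro k hk hA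
    by_contra hk0
    apply hmin (m - k) (by omega)
    refine ⟨fun l => u (l + k), by simpa using hA, ?_, ?_⟩
    · have : m - k + k = m := by omega
      simpa [this] using h1
    · intro l hl
      have := h2 (l + k) (by omega)
      have e : l + 1 + k = l + k + 1 := by omega
      simpa [e] using this
  · intro k hk hC
    by_contra hk0
    exact hmin k (by omega) ⟨u, h0, hC, fun l hl => h2 l (by omega)⟩
  · intro k l hkl hlm hr
    by_contra hne
    apply hmin (m - (l - k - 1)) (by omega)
    refine ⟨fun t => if t ≤ k then u t else u (t + (l - k - 1)), by simpa using h0, ?_, ?_⟩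
    · have : ¬ (m - (l - k - 1) ≤ k) := by omega
      have e : m - (l - k - 1) + (l - k - 1) = m := by omega
      simpa [this, e] using h1
    · intro t ht
      rcases lt_trichotomy t k with h | h | h
      · simp only [h.le, if_true, Nat.succ_le_of_lt h]; exact h2 t (by omega)
      · subst h
        have e : t + 1 + (l - t - 1) = l := by omega
        simpa [e] using hr
      · have e1 : ¬ t ≤ k := by omega
        have e2 : ¬ t + 1 ≤ k := by omega
        have e3 : t + 1 + (l - k - 1) = t + (l - k - 1) + 1 := by omega
        simp only [e1, e2, if_false, e3]
        exact h2 _ (by omega)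

end Part1

section Part2

/-- edges avoiding a set of observed conditioning vertices -/
def EAv {U W : Type} (e : W → U) (E : U → U → Prop) (a b : U) : Prop := E a b ∧ ∀ w, e w ≠ a

def RAv {U W : Type} (e : W → U) (E : U → U → Prop) : U → U → Prop :=
  Relation.ReflTransGen (EAv e E)

def LAv {U W : Type} (e : W → U) (E : U → U → Prop) (u v : U) : Prop :=
  ∃ w, RAv e E u (e w) ∧ RAv e E v (e w)

lemma LAv_symm {U W : Type} {e : W → U} {E : U → U → Prop} {u v : U} (h : LAv e E u v) :
    LAv e E v u := by
  obtain ⟨w, h1, h2⟩ := h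
  exact ⟨w, h2, h1⟩

lemma RAv_e {U W : Type} {e : W → U} {E : U → U → Prop} {w : W} {v : U} (h : RAv e E (e w) v) :
    v = e w := by
  rcases Relation.ReflTransGen.cases_head h with h | ⟨c, hc, _⟩
  · exact h.symm
  · exact absurd rfl (hc.2 w)

def oel {U W : Type} (e : W → U) (i : U) : Option W → U
  | none => i
  | some w => e w

lemma det_zero_of_pos {U W : Type} [Fintype U] [DecidableEq U] [Fintype W] [DecidableEq W]
    (T : Matrix U U ℝ) (ei ej : W → U)
    (h : ∀ ω : U → ℝ, (∀ u, 0 < ω u) →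
      (Matrix.of fun a b => ∑ u, ω u * T u (ei a) * T u (ej b)).det = 0)
    (ω : U → ℝ) (hω : ∀ u, 0 ≤ ω u) :
    (Matrix.of fun a b => ∑ u, ω u * T u (ei a) * T u (ej b)).det = 0 := by
  let F : ℝ → ℝ := fun t =>
    (Matrix.of fun a b => ∑ u, (ω u + t) * T u (ei a) * T u (ej b)).det
  have hF : Continuous F := by
    apply Continuous.matrix_det
    apply continuous_matrix
    intro a b
    simp only [Matrix.of_apply]
    fun_prop
  have h1 : Filter.Tendsto F (nhdsWithin 0 (Set.Ioi 0)) (nhds (F 0)) :=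
    (hF.tendsto 0).mono_left nhdsWithin_le_nhds
  have h2 : Filter.Tendsto F (nhdsWithin 0 (Set.Ioi 0)) (nhds 0) := by
    apply tendsto_const_nhds.congr'
    filter_upwards [self_mem_nhdsWithin] with t ht
    exact (h (fun u => ω u + t) (fun u => add_pos_of_nonneg_of_pos (hω u) ht)).symm
  have h3 := tendsto_nhds_unique h1 h2
  simpa [F] using h3

lemma no_conn {U W : Type} [Fintype U] [DecidableEq U] [Fintype W] [DecidableEq W]
    {E : U → U → Prop} (hE : WellFounded E) (e : W → U) (he : Function.Injective e)
    (i j : U) (hi : ∀ w, e w ≠ i) (hj : ∀ w, e w ≠ j)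
    (hdet : ∀ S ∈ DigraphCov E, (Matrix.of fun a b => S (oel e i a) (oel e j b)).det = 0) :
    ¬ ∃ u v, RAv e E u i ∧ Relation.ReflTransGen (LAv e E) u v ∧ RAv e E v j := by
  classical
  intro hcon
  obtain ⟨m, u, hui, huj, hlink, hi0, hjm, hshort⟩ :=
    exists_min_chain (LAv e E) (fun u => RAv e E u i) (fun v => RAv e E v j) hcon
  have hWF : WellFounded (EAv e E) := Subrelation.wf (fun {a b} h => h.1) hE
  let Λ : Matrix U U ℝ := fun a b => if EAv e E a b then 1 else 0
  have hΛ : SupportedOn (EAv e E) Λ := fun a b h => by simp [Λ, h]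
  have hΛE : SupportedOn E Λ := fun a b h => hΛ a b (fun h' => h h'.1)
  have hΛ0 : ∀ a b, 0 ≤ Λ a b := fun a b => by simp only [Λ]; split_ifs <;> norm_num
  have hΛ1 : ∀ a b, EAv e E a b → 0 < Λ a b := fun a b h => by simp [Λ, h]
  obtain ⟨T, hT⟩ : ∃ T, T = (1 - Λ)⁻¹ := ⟨_, rfl⟩
  have Tpos : ∀ v w, RAv e E v w → 0 < T v w := fun v w h => by
    rw [hT]; exact T_pos hWF hΛ hΛ0 hΛ1 v w h
  have Tz : ∀ v w, ¬ RAv e E v w → T v w = 0 := fun v w h => by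
    rw [hT]; exact T_supp hWF hΛ v w h
  -- linking vertices
  have hlink' : ∀ k : Fin m, ∃ w : W, RAv e E (u k) (e w) ∧ RAv e E (u (k + 1)) (e w) :=
    fun k => hlink k k.2
  choose q hq using hlink'
  have hq2 : ∀ (k : ℕ) (l : Fin m), k ≤ m → RAv e E (u k) (e (q l)) → k = l ∨ k = l + 1 := by
    intro k l hk h
    have hl := l.2
    have a1 : LAv e E (u k) (u l) := ⟨_, h, (hq l).1⟩
    have a2 : LAv e E (u k) (u (l + 1)) := ⟨_, h, (hq l).2⟩
    rcases lt_or_ge k l with h1 | h1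
    · have := hshort k (l + 1) (by omega) (by omega) a2
      omega
    · rcases eq_or_ne k l with h2 | h2
      · exact Or.inl h2
      · have := hshort l k (by omega) (by omega) (LAv_symm a1)
        omega
  have hqinj : Function.Injective q := by
    intro k l hkl
    have h1 := hq2 k l k.2.le (hkl ▸ (hq k).1)
    have h2 := hq2 (k + 1) l k.2 (hkl ▸ (hq k).2)
    apply Fin.ext
    omega
  let s : Option W → U
    | none => u 0
    | some w => if h : ∃ l : Fin m, q l = w then u (h.choose + 1) else e w
  have hs1 : ∀ l : Fin m, s (some (q l)) = u (l + 1) := by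
    intro l
    have h : ∃ l' : Fin m, q l' = q l := ⟨l, rfl⟩
    have h2 : h.choose = l := hqinj h.choose_spec
    simp only [s, dif_pos h, h2]
  have hs2 : ∀ w, (∀ l, q l ≠ w) → s (some w) = e w := by
    intro w hw
    have h : ¬ ∃ l : Fin m, q l = w := fun ⟨l, h⟩ => hw l h
    simp only [s, dif_neg h]
  -- generic consequence of being in the kernel
  have hker : ∀ (c : U) (hc : ∀ w, e w ≠ c) (x : Option W → ℝ),
      (Matrix.of fun a b => T (s a) (oel e c b)) *ᵥ x = 0 →
      (∀ w, (∀ l, q l ≠ w) → x (some w) = 0) ∧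
      ∀ k ≤ m, T (u k) c * x none + ∑ l : Fin m, T (u k) (e (q l)) * x (some (q l)) = 0 := by
    intro c hc x hx
    have hrow : ∀ a, T (s a) c * x none + ∑ w, T (s a) (e w) * x (some w) = 0 := by
      intro a
      have := congrFun hx a
      simpa [Matrix.mulVec, dotProduct, Fintype.sum_option, oel] using this
    have hz : ∀ w, (∀ l, q l ≠ w) → x (some w) = 0 := by
      intro w hw
      have h := hrow (some w)
      rw [hs2 w hw, Tz (e w) c (fun h => hc w (RAv_e h).symm), zero_mul, zero_add,
        Finset.sum_eq_single w] at h
      · have := Tpos (e w) (e w) Relation.ReflTransGen.refl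
        exact (mul_eq_zero.1 h).resolve_left this.ne'
      · intro b _ hb
        rw [Tz (e w) (e b) (fun h => hb (he (RAv_e h))), zero_mul]
      · simp
    refine ⟨hz, ?_⟩
    intro k hk
    have h : T (u k) c * x none + ∑ w, T (u k) (e w) * x (some w) = 0 := by
      rcases Nat.eq_zero_or_pos k with rfl | hk0
      · exact hrow none
      · have := hrow (some (q ⟨k - 1, by omega⟩))
        rw [hs1] at this
        have e1 : k - 1 + 1 = k := by omega
        simpa [e1] using this
    rw [← h]
    congr 1
    rw [← Finset.sum_image (s := Finset.univ) (g := q)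
      (f := fun w => T (u k) (e w) * x (some w)) (fun a _ b _ h => hqinj h)]
    apply Finset.sum_subset (Finset.subset_univ _)
    intro w _ hw
    rw [hz w, mul_zero]
    intro l hl
    exact hw (Finset.mem_image.2 ⟨l, Finset.mem_univ _, hl⟩)
  have hNi : (Matrix.of fun a b => T (s a) (oel e i b)).det ≠ 0 := by
    intro h0
    obtain ⟨x, hx, hx0⟩ := Matrix.exists_mulVec_eq_zero_iff.2 h0
    apply hx
    obtain ⟨h1, h2⟩ := hker i hi x hx0
    have h3 : ∀ d : ℕ, ∀ l : Fin m, m ≤ l + d → x (some (q l)) = 0 := by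
      intro d
      induction d with
      | zero => intro l hl; have := l.2; omega
      | succ d ih =>
        intro l hl
        have hl2 := l.2
        have h4 := h2 (l + 1) (by omega)
        rw [Tz (u (l + 1)) i (fun h => by have := hi0 (l + 1) (by omega) h; omega), zero_mul,
          zero_add, Finset.sum_eq_single l] at h4
        · exact (mul_eq_zero.1 h4).resolve_left (Tpos _ _ (hq l).2).ne'
        · intro l' _ hl'
          have hne : (l' : ℕ) ≠ l := fun h => hl' (Fin.ext h)
          by_cases hR : RAv e E (u (l + 1)) (e (q l'))
          · have := hq2 _ l' (by omega) hR
            rw [ih l' (by omega), mul_zero]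
          · rw [Tz _ _ hR, zero_mul]
        · simp
    have h5 : ∀ w, x (some w) = 0 := by
      intro w
      by_cases hw : ∃ l, q l = w
      · obtain ⟨l, rfl⟩ := hw
        exact h3 m l (by omega)
      · exact h1 w (fun l hl => hw ⟨l, hl⟩)
    have h6 := h2 0 (Nat.zero_le _)
    simp only [h5, mul_zero, Finset.sum_const_zero, add_zero] at h6
    funext a
    cases a with
    | none => exact (mul_eq_zero.1 h6).resolve_left (Tpos _ _ hui).ne'
    | some w => exact h5 w
  have hNj : (Matrix.of fun a b => T (s a) (oel e j b)).det ≠ 0 := by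
    intro h0
    obtain ⟨x, hx, hx0⟩ := Matrix.exists_mulVec_eq_zero_iff.2 h0
    apply hx
    obtain ⟨h1, h2⟩ := hker j hj x hx0
    have h3 : ∀ d : ℕ, ∀ l : Fin m, (l : ℕ) < d → x (some (q l)) = 0 := by
      intro d
      induction d with
      | zero => intro l hl; omega
      | succ d ih =>
        intro l hl
        have hl2 := l.2
        have h4 := h2 l (by omega)
        rw [Tz (u l) j (fun h => by have := hjm l (by omega) h; omega), zero_mul,
          zero_add, Finset.sum_eq_single l] at h4
        · exact (mul_eq_zero.1 h4).resolve_left (Tpos _ _ (hq l).1).ne'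
        · intro l' _ hl'
          have hne : (l' : ℕ) ≠ l := fun h => hl' (Fin.ext h)
          by_cases hR : RAv e E (u l) (e (q l'))
          · have := hq2 _ l' (by omega) hR
            rw [ih l' (by omega), mul_zero]
          · rw [Tz _ _ hR, zero_mul]
        · simp
    have h5 : ∀ w, x (some w) = 0 := by
      intro w
      by_cases hw : ∃ l, q l = w
      · obtain ⟨l, rfl⟩ := hw
        exact h3 m l l.2
      · exact h1 w (fun l hl => hw ⟨l, hl⟩)
    have h6 := h2 m le_rfl
    simp only [h5, mul_zero, Finset.sum_const_zero, add_zero] at h6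
    funext a
    cases a with
    | none => exact (mul_eq_zero.1 h6).resolve_left (Tpos _ _ huj).ne'
    | some w => exact h5 w
  -- degenerate error variances
  have hfin := det_zero_of_pos T (oel e i) (oel e j) (fun ω hω => by
    have := hdet (Tᵀ * Matrix.diagonal ω * T) ⟨Λ, Matrix.diagonal ω, hΛE,
      Matrix.isDiag_diagonal ω, fun u => by simpa using hω u, by rw [hT]⟩
    rw [← this]
    congr 1
    ext a b
    rw [Matrix.of_apply, Matrix.of_apply, cov_entry (Matrix.isDiag_diagonal ω)]
    simp) (fun v => ∑ a, if s a = v then 1 else 0)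
    (fun v => Finset.sum_nonneg fun a _ => by split_ifs <;> norm_num)
  have hprod : (Matrix.of fun a b => ∑ v, (∑ a, if s a = v then (1 : ℝ) else 0) *
      T v (oel e i a) * T v (oel e j b)) =
      (Matrix.of fun a b => T (s a) (oel e i b))ᵀ * (Matrix.of fun a b => T (s a) (oel e j b)) := by
    ext a b
    rw [Matrix.mul_apply]
    simp only [Matrix.of_apply, Matrix.transpose_apply, Finset.sum_mul]
    rw [Finset.sum_comm]
    apply Finset.sum_congr rfl
    intro c _
    rw [Finset.sum_eq_single (s c)]
    · simp
    · intro v _ hv; rw [if_neg hv.symm]; ring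
    · simp
  rw [hprod, Matrix.det_mul, Matrix.det_transpose] at hfin
  exact (mul_ne_zero hNi hNj) hfin

end Part2

section Part3

lemma mixed_det {V : Type} [Fintype V] [DecidableEq V] {D : V → V → Prop} {B : SimpleGraph V}
    (hD : WellFounded D) (R : V → Prop) [DecidablePred R]
    (hR : ∀ a b, D a b ∨ B.Adj a b → R a → R b)
    (c d : V) (hd : R d) (hcd : c ≠ d) (hna : ¬ B.Adj c d)
    (pac : ∀ v, D v c → ¬ R v) (pad : ∀ v, D v d → ¬ R v)
    (S : Matrix V V ℝ) (hS : S ∈ MixedCov D B) :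
    (Matrix.of fun a b : Option {v // ¬ R v} =>
      S (oel Subtype.val c a) (oel Subtype.val d b)).det = 0 := by
  obtain ⟨Λ, Ω, hΛ, hΩ, hB, rfl⟩ := hS
  set T := (1 - Λ)⁻¹ with hT
  set S := Tᵀ * Ω * T with hSdef
  have hS1 : S * (1 - Λ) = Tᵀ * Ω := by
    rw [hSdef, Matrix.mul_assoc, Matrix.nonsing_inv_mul _ (det_one_sub hD hΛ), Matrix.mul_one]
  have hDR : ∀ v w, Relation.ReflTransGen D v w → R v → R w := by
    intro v w h
    induction h with
    | refl => exact id
    | tail _ h2 ih => exact fun h => hR _ _ (Or.inl h2) (ih h)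
  have hΩR : ∀ v, ¬ R v → Ω v d = 0 := by
    intro v hv
    apply hB
    · rintro rfl; exact hv hd
    · intro h; exact hv (hR _ _ (Or.inr h.symm) hd)
  have hz : ∀ a : Option {v // ¬ R v}, (Tᵀ * Ω) (oel Subtype.val c a) d = 0 := by
    intro a
    rw [Matrix.mul_apply]
    apply Finset.sum_eq_zero
    intro v _
    rw [Matrix.transpose_apply]
    by_cases hv : Relation.ReflTransGen D v (oel Subtype.val c a)
    · suffices Ω v d = 0 by rw [this, mul_zero]
      cases a with
      | some w => exact hΩR v fun h => w.2 (hDR _ _ hv h)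
      | none =>
        rcases Relation.ReflTransGen.cases_tail hv with h | ⟨b, h1, h2⟩
        · change c = v at h
          subst h; exact hB _ _ hcd hna
        · exact hΩR v fun h => pac b h2 (hDR _ _ h1 h)
    · rw [hT, T_supp hD hΛ _ _ hv, zero_mul]
  apply Matrix.exists_mulVec_eq_zero_iff.1
  refine ⟨fun b => match b with | none => 1 | some p => - Λ p.1 d, ?_, ?_⟩
  · intro h; have := congrFun h none; simp at this
  · funext a
    have h1 := hz a
    rw [← hS1, mul_sub, mul_one, Matrix.sub_apply, Matrix.mul_apply] at h1
    simp only [Matrix.mulVec, dotProduct, Fintype.sum_option, Matrix.of_apply, Pi.zero_apply]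
    have h2 : ∑ v, S (oel Subtype.val c a) v * Λ v d =
        ∑ p : {v // ¬ R v}, S (oel Subtype.val c a) p.1 * Λ p.1 d := by
      rw [← Finset.sum_subtype (s := Finset.univ.filter fun v => ¬ R v) (p := fun v => ¬ R v)
        (by simp) (f := fun v => S (oel Subtype.val c a) v * Λ v d)]
      symm
      apply Finset.sum_subset (Finset.subset_univ _)
      intro v _ hv
      rw [hΛ v d, mul_zero]
      intro hD'
      exact hv (by simpa using pad v hD')
    rw [h2] at h1
    rw [← h1]
    simp [sub_eq_add_neg, oel]

lemma supp_resid {U W : Type} [Fintype U] [DecidableEq U]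
    {E : U → U → Prop} (hE : WellFounded E) (e : W → U)
    (i : U) {Λ : Matrix U U ℝ} (hΛ : SupportedOn E Λ) (ω : U → ℝ) (hω : ∀ u, 0 < ω u)
    (hort : ∀ p, ∑ v, ω v * (1 - Λ)⁻¹ v i * (1 - Λ)⁻¹ v (e p) = 0)
    (u : U) (hu : ¬ ∃ v, Relation.ReflTransGen (LAv e E) u v ∧ RAv e E v i) :
    (1 - Λ)⁻¹ u i = 0 := by
  classical
  have hWF : WellFounded (EAv e E) := Subrelation.wf (fun {a b} h => h.1) hE
  let Λ0 : Matrix U U ℝ := fun a b => if ∃ w, e w = a then 0 else Λ a b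
  have hΛ0 : SupportedOn (EAv e E) Λ0 := by
    intro a b h
    by_cases ha : ∃ w, e w = a
    · simp [Λ0, ha]
    · have : ¬ E a b := fun h' => h ⟨h', fun w hw => ha ⟨w, hw⟩⟩
      simp [Λ0, hΛ a b this]
  have hτ : ∀ v w, ¬ RAv e E v w → (1 - Λ0)⁻¹ v w = 0 := fun v w h => T_supp hWF hΛ0 v w h
  have u1 := det_one_sub hE hΛ
  have u0 := det_one_sub hWF hΛ0
  obtain ⟨F, hF⟩ : ∃ F, F = Λ - Λ0 := ⟨_, rfl⟩
  have hF0 : ∀ a b, (∀ w, e w ≠ a) → F a b = 0 := by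
    intro a b h
    have ha : ¬ ∃ w, e w = a := fun ⟨w, hw⟩ => h w hw
    rw [hF, Matrix.sub_apply]
    simp [Λ0, ha]
  set T := (1 - Λ)⁻¹ with hT
  obtain ⟨τ, hτd⟩ : ∃ τ, τ = (1 - Λ0)⁻¹ := ⟨_, rfl⟩
  rw [← hτd] at hτ
  have a1 : T * (1 - Λ) = 1 := Matrix.nonsing_inv_mul _ u1
  have a2 : (1 - Λ) * T = 1 := Matrix.mul_nonsing_inv _ u1
  have b1 : τ * (1 - Λ0) = 1 := by rw [hτd]; exact Matrix.nonsing_inv_mul _ u0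
  have b2 : (1 - Λ0) * τ = 1 := by rw [hτd]; exact Matrix.mul_nonsing_inv _ u0
  have hF' : F = (1 - Λ0) - (1 - Λ) := by rw [hF]; abel
  have id1 : τ = T - T * (F * τ) := by
    rw [hF', sub_mul, b2, mul_sub, ← Matrix.mul_assoc, a1]; simp
  have id2 : T = τ + τ * (F * T) := by
    rw [hF', sub_mul, a2, mul_sub, ← Matrix.mul_assoc, b1]; simp
  have hrow : ∀ (M : Matrix U U ℝ) (x y : U), (∀ w, e w ≠ x) → (F * M) x y = 0 := by
    intro M x y h
    rw [Matrix.mul_apply]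
    exact Finset.sum_eq_zero fun z _ => by rw [hF0 x z h, zero_mul]
  -- orthogonality to the transformed variables
  have hort2 : ∀ p, ∑ v, ω v * T v i * τ v (e p) = 0 := by
    intro p
    have h1 : ∀ v, ω v * T v i * τ v (e p) = ω v * T v i * T v (e p) -
        ∑ x, (F * τ) x (e p) * (ω v * T v i * T v x) := by
      intro v
      have : τ v (e p) = T v (e p) - ∑ x, T v x * (F * τ) x (e p) := by
        conv_lhs => rw [id1]
        rw [Matrix.sub_apply, Matrix.mul_apply]
      rw [this, mul_sub, Finset.mul_sum]
      congr 1
      exact Finset.sum_congr rfl fun x _ => by ring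
    rw [Finset.sum_congr rfl fun v _ => h1 v, Finset.sum_sub_distrib, hort p, Finset.sum_comm]
    rw [zero_sub, neg_eq_zero]
    apply Finset.sum_eq_zero
    intro x _
    rw [← Finset.mul_sum]
    by_cases hx : ∃ w, e w = x
    · obtain ⟨w, rfl⟩ := hx
      rw [hort w, mul_zero]
    · rw [hrow τ x _ fun w hw => hx ⟨w, hw⟩, zero_mul]
  let K : Finset U := Finset.univ.filter fun v => Relation.ReflTransGen (LAv e E) u v
  have hK : ∀ v, v ∈ K ↔ Relation.ReflTransGen (LAv e E) u v := by simp [K]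
  have hort3 : ∀ p, ∑ v ∈ K, ω v * T v i * τ v (e p) = 0 := by
    intro p
    by_cases hp : ∃ v ∈ K, RAv e E v (e p)
    · obtain ⟨v, hv, hvp⟩ := hp
      rw [← hort2 p]
      apply Finset.sum_subset (Finset.subset_univ _)
      intro x _ hx
      rw [hτ, mul_zero]
      intro hxp
      exact hx ((hK x).2 (((hK v).1 hv).tail ⟨p, hvp, hxp⟩))
    · exact Finset.sum_eq_zero fun v hv => by
        rw [hτ _ _ fun h => hp ⟨v, hv, h⟩, mul_zero]
  have hTK : ∀ v ∈ K, T v i = ∑ x, τ v x * (F * T) x i := by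
    intro v hv
    conv_lhs => rw [id2]
    rw [Matrix.add_apply, Matrix.mul_apply, hτ v i, zero_add]
    intro h
    exact hu ⟨v, (hK v).1 hv, h⟩
  have hsum : ∑ v ∈ K, ω v * (T v i) ^ 2 = 0 := by
    have h1 : ∀ v ∈ K, ω v * (T v i) ^ 2 =
        ∑ x, (F * T) x i * (ω v * T v i * τ v x) := by
      intro v hv
      have : ω v * (T v i) ^ 2 = ω v * T v i * T v i := by ring
      have h3 : ω v * T v i * T v i = ω v * T v i * ∑ x, τ v x * (F * T) x i :=
        congrArg (fun z => ω v * T v i * z) (hTK v hv)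
      rw [this, h3, Finset.mul_sum]
      exact Finset.sum_congr rfl fun x _ => by ring
    rw [Finset.sum_congr rfl h1, Finset.sum_comm]
    apply Finset.sum_eq_zero
    intro x _
    rw [← Finset.mul_sum]
    by_cases hx : ∃ w, e w = x
    · obtain ⟨w, rfl⟩ := hx
      rw [hort3 w, mul_zero]
    · rw [hrow T x _ fun w hw => hx ⟨w, hw⟩, zero_mul]
  have := (Finset.sum_eq_zero_iff_of_nonneg
    (fun v _ => mul_nonneg (hω v).le (sq_nonneg _))).1 hsum u ((hK u).2 .refl)
  rcases mul_eq_zero.1 this with h | h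
  · exact absurd h (hω u).ne'
  · exact pow_eq_zero_iff (two_ne_zero) |>.1 h

lemma cyc_ineq {n : ℕ} [NeZero n] (h1 : (1 : ZMod n) ≠ 0) (h2 : (2 : ZMod n) ≠ 0)
    (h3 : (3 : ZMod n) ≠ 0) (a s : ZMod n → ℝ) (hs : ∀ k, s k ^ 2 = 1)
    (h : ∀ k l, a k ≠ 0 → a l ≠ 0 → k = l ∨ l = k + 1 ∨ k = l + 1) :
    0 ≤ ∑ k, (a k ^ 2 - 2 * (s k * (a k * a (k + 1)))) := by
  rw [Finset.sum_sub_distrib]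
  by_cases hk : ∃ k, a k ≠ 0 ∧ a (k + 1) ≠ 0
  · obtain ⟨k, hk1, hk2⟩ := hk
    rw [Finset.sum_eq_single (a := k) (f := fun k => 2 * (s k * (a k * a (k + 1))))]
    · have hne : k ≠ k + 1 := by intro h; exact h1 (by linear_combination -h)
      have : ∑ x ∈ {k, k + 1}, a x ^ 2 ≤ ∑ x, a x ^ 2 :=
        Finset.sum_le_sum_of_subset_of_nonneg (Finset.subset_univ _) fun _ _ _ => sq_nonneg _
      rw [Finset.sum_pair hne] at this
      nlinarith [sq_nonneg (a k - s k * a (k + 1)), hs k]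
    · intro l _ hlk
      by_contra hne
      have hl1 : a l ≠ 0 := by intro h; apply hne; rw [h]; ring
      have hl2 : a (l + 1) ≠ 0 := by intro h; apply hne; rw [h]; ring
      rcases h k l hk1 hl1 with h' | h' | h'
      · exact hlk h'.symm
      · subst h'
        rcases h _ _ hk1 hl2 with h' | h' | h'
        · exact h2 (by linear_combination -h')
        · exact h1 (by linear_combination h')
        · exact h3 (by linear_combination -h')
      · subst h'
        rcases h _ _ hl1 hk2 with h' | h' | h'
        · exact h2 (by linear_combination -h')
        · exact h1 (by linear_combination h')
        · exact h3 (by linear_combination -h')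
    · simp
  · rw [Finset.sum_eq_zero (f := fun k => 2 * (s k * (a k * a (k + 1))))]
    · rw [sub_zero]; exact Finset.sum_nonneg fun _ _ => sq_nonneg _
    · intro k _
      by_contra hne
      exact hk ⟨k, by intro h; apply hne; rw [h]; ring, by intro h; apply hne; rw [h]; ring⟩

lemma posDef_sub {V : Type} [Fintype V] [DecidableEq V] {Ω : Matrix V V ℝ} (h : Ω.PosDef) :
    ∃ δ : ℝ, 0 < δ ∧ (Ω - δ • (1 : Matrix V V ℝ)).PosDef := by
  have hA := h.1
  have hpos := h.eigenvalues_pos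
  obtain ⟨δ, hδ, hlt⟩ : ∃ δ : ℝ, 0 < δ ∧ ∀ i, δ < hA.eigenvalues i := by
    rcases isEmpty_or_nonempty V with hV | hV
    · exact ⟨1, one_pos, fun i => hV.elim i⟩
    · obtain ⟨i0, hi0⟩ := Finite.exists_min hA.eigenvalues
      exact ⟨hA.eigenvalues i0 / 2, half_pos (hpos i0), fun i =>
        lt_of_lt_of_le (half_lt_self (hpos i0)) (hi0 i)⟩
  refine ⟨δ, hδ, ?_⟩
  have e1 : Ω - δ • (1 : Matrix V V ℝ) =
      Unitary.conjStarAlgAut ℝ _ hA.eigenvectorUnitary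
        (Matrix.diagonal fun i => hA.eigenvalues i - δ) := by
    have e2 : (Matrix.diagonal fun i => hA.eigenvalues i - δ) =
        Matrix.diagonal (RCLike.ofReal ∘ hA.eigenvalues) - δ • (1 : Matrix V V ℝ) := by
      ext i j
      by_cases hij : i = j
      · subst hij; simp
      · simp [Matrix.diagonal_apply_ne _ hij, Matrix.one_apply_ne hij]
    rw [e2, map_sub, ← hA.spectral_theorem, map_smul, map_one]
  rw [e1, Unitary.conjStarAlgAut_apply, ← Unitary.coe_star]
  rw [Unitary.coe_star, Unitary.isUnit_coe.posDef_star_right_conjugate_iff]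
  exact Matrix.PosDef.diagonal fun i => sub_pos.2 (hlt i)

lemma cyc_matrix {V : Type} [Fintype V] [DecidableEq V] (B : SimpleGraph V) {n : ℕ} [NeZero n]
    (h1 : (1 : ZMod n) ≠ 0) (h2 : (2 : ZMod n) ≠ 0)
    (f : ZMod n → V) (hf : Function.Injective f) (hadj : ∀ i, B.Adj (f i) (f (i + 1))) :
    ∃ (s : ZMod n → ℝ) (Ω : Matrix V V ℝ), (∀ k, s k ^ 2 = 1) ∧ Ω.PosDef ∧ BSupported B Ω ∧
      (∀ k v, (∀ l, f l ≠ v) → Ω (f k) v = 0) ∧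
      ∀ k, Ω (f k) (f k) = 2 ∧ Ω (f k) (f (k + 1)) = s k := by
  classical
  let s : ZMod n → ℝ := fun k => if k + 1 = 0 then 1 else -1
  have hs : ∀ k, s k ^ 2 = 1 := fun k => by simp only [s]; split_ifs <;> norm_num
  let G : Matrix (ZMod n) V ℝ := fun k v =>
    (if v = f k then 1 else 0) + s k * (if v = f (k + 1) then 1 else 0)
  let χ : V → ℝ := fun v => if ∀ l, f l ≠ v then 1 else 0
  have hχ : ∀ k, χ (f k) = 0 := by
    intro k
    have : ¬ ∀ l, f l ≠ f k := fun h => h k rfl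
    simp only [χ, if_neg this]
  have hGz : ∀ k v, v ≠ f k → v ≠ f (k + 1) → G k v = 0 := by
    intro k v ha hb
    simp [G, ha, hb]
  have hent : ∀ u v, (Gᵀ * G + Matrix.diagonal χ) u v =
      ∑ k, G k u * G k v + Matrix.diagonal χ u v := by
    intro u v
    rw [Matrix.add_apply, Matrix.mul_apply]
    rfl
  refine ⟨s, Gᵀ * G + Matrix.diagonal χ, hs, ?_, ?_, ?_, ?_⟩
  · apply Matrix.PosDef.of_dotProduct_mulVec_pos
    · apply Matrix.IsHermitian.add
      · exact Matrix.isHermitian_conjTranspose_mul_self G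
      · exact Matrix.isHermitian_diagonal χ
    · intro x hx
      have hq : star x ⬝ᵥ ((Gᵀ * G + Matrix.diagonal χ) *ᵥ x) =
          ∑ k, ((G *ᵥ x) k) ^ 2 + ∑ v, χ v * x v ^ 2 := by
        rw [Matrix.add_mulVec, dotProduct_add, ← Matrix.mulVec_mulVec, Matrix.dotProduct_mulVec,
          Matrix.vecMul_transpose]
        simp only [star_trivial, dotProduct, Matrix.mulVec_diagonal]
        congr 1
        · exact Finset.sum_congr rfl fun k _ => by ring
        · exact Finset.sum_congr rfl fun k _ => by ring
      have p1 : 0 ≤ ∑ k, ((G *ᵥ x) k) ^ 2 := Finset.sum_nonneg fun _ _ => sq_nonneg _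
      have hχ0 : ∀ v, 0 ≤ χ v := fun v => by simp only [χ]; split_ifs <;> norm_num
      have p2 : 0 ≤ ∑ v, χ v * x v ^ 2 :=
        Finset.sum_nonneg fun v _ => mul_nonneg (hχ0 v) (sq_nonneg _)
      rw [hq]
      by_contra hcon
      apply hx
      have z1 : ∑ k, ((G *ᵥ x) k) ^ 2 = 0 := by linarith
      have z2 : ∑ v, χ v * x v ^ 2 = 0 := by linarith
      have z1' : ∀ k, x (f k) + s k * x (f (k + 1)) = 0 := by
        intro k
        have := (Finset.sum_eq_zero_iff_of_nonneg (fun _ _ => sq_nonneg _)).1 z1 k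
          (Finset.mem_univ _)
        have := pow_eq_zero_iff (two_ne_zero) |>.1 this
        rw [← this]
        simp [Matrix.mulVec, dotProduct, G, add_mul, Finset.sum_add_distrib]
      have hm : ∀ m : ℕ, m < n → x (f (m : ZMod n)) = x (f 0) := by
        intro m
        induction m with
        | zero => simp
        | succ m ih =>
          intro hm
          have a1 := ih (by omega)
          have a2 := z1' (m : ZMod n)
          have a3 : ((m : ZMod n) + 1) ≠ 0 := by
            intro h
            have h' : ((m + 1 : ℕ) : ZMod n) = 0 := by push_cast; exact h
            rw [ZMod.natCast_eq_zero_iff] at h'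
            exact absurd (Nat.le_of_dvd (by omega) h') (by omega)
          simp only [s, if_neg a3] at a2
          push_cast
          linarith
      have hall : ∀ k, x (f k) = x (f 0) := by
        intro k
        have := hm k.val (ZMod.val_lt k)
        rwa [ZMod.natCast_zmod_val] at this
      have h0 : x (f 0) = 0 := by
        have := z1' (-1)
        rw [hall, hall (-1 + 1)] at this
        simp [s] at this
        linarith
      funext v
      by_cases hv : ∀ l, f l ≠ v
      · have := (Finset.sum_eq_zero_iff_of_nonneg
          (fun v _ => mul_nonneg (hχ0 v) (sq_nonneg _))).1 z2 v (Finset.mem_univ _)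
        simp only [χ, if_pos hv, one_mul] at this
        exact pow_eq_zero_iff (two_ne_zero) |>.1 this
      · push Not at hv
        obtain ⟨l, rfl⟩ := hv
        rw [hall, h0]; rfl
  · intro u v huv hna
    rw [hent, Matrix.diagonal_apply_ne _ huv, add_zero]
    apply Finset.sum_eq_zero
    intro k _
    by_contra hne
    have a1 : u = f k ∨ u = f (k + 1) := by
      by_contra h; push Not at h; exact hne (by rw [hGz k u h.1 h.2, zero_mul])
    have a2 : v = f k ∨ v = f (k + 1) := by
      by_contra h; push Not at h; exact hne (by rw [hGz k v h.1 h.2, mul_zero])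
    rcases a1 with rfl | rfl <;> rcases a2 with rfl | rfl
    · exact huv rfl
    · exact hna (hadj k)
    · exact hna (hadj k).symm
    · exact huv rfl
  · intro k v hv
    rw [hent, Matrix.diagonal_apply_ne _ (hv k), add_zero]
    apply Finset.sum_eq_zero
    intro l _
    rw [hGz l v (fun h => hv l h.symm) (fun h => hv _ h.symm), mul_zero]
  · intro k
    have hG : ∀ k l, G k (f l) = (if l = k then 1 else 0) + s k * (if l = k + 1 then 1 else 0) := by
      intro k l
      simp only [G, hf.eq_iff]
    have hne : ∀ k : ZMod n, k ≠ k + 1 := fun k h => h1 (by linear_combination -h)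
    constructor
    · rw [hent, Matrix.diagonal_apply_eq, hχ, add_zero]
      rw [Finset.sum_eq_add (a := k) (b := k - 1)]
      · rw [hG, hG]
        have e1 : k ≠ k - 1 := fun h => h1 (by linear_combination h)
        have := hs (k - 1)
        simp only [if_true, if_neg (hne k), if_neg e1, sub_add_cancel]
        nlinarith
      · exact fun h => h1 (by linear_combination h)
      · intro c _ hc
        rw [hG, if_neg hc.1.symm, if_neg (fun h => hc.2 (by linear_combination -h))]
        ring
      · simp
      · simp
    · rw [hent, Matrix.diagonal_apply_ne _ (fun h => hne k (hf h)), add_zero]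
      rw [Finset.sum_eq_single k]
      · rw [hG, hG, if_pos rfl, if_neg (hne k), if_pos rfl, if_neg (hne k).symm]
        ring
      · intro c _ hc
        rw [hG, hG, if_neg hc.symm]
        by_cases h3 : k = c + 1
        · subst h3
          have e1 : c + 1 + 1 ≠ c := fun h => h2 (by linear_combination h)
          rw [if_neg e1, if_neg (hne (c + 1)).symm]
          ring
        · rw [if_neg h3]; ring
      · simp

lemma forward {V : Type} [Fintype V] [DecidableEq V] (D : V → V → Prop)
    (B : SimpleGraph V) (hCG : ChainGraph D B) (hS : StrictlyGaussianCausal D B) : Chordal B := by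
  classical
  intro n hn f hf hadj
  by_contra hcon
  have hna : ∀ i j, i ≠ j → j ≠ i + 1 → i ≠ j + 1 → ¬ B.Adj (f i) (f j) :=
    fun i j h1 h2 h3 h4 => hcon ⟨i, j, h2, h3, h1, h4⟩
  have : NeZero n := ⟨by omega⟩
  have hcast : ∀ m : ℕ, 0 < m → m < 4 → (m : ZMod n) ≠ 0 := by
    intro m hm hm4 h
    rw [ZMod.natCast_eq_zero_iff] at h
    have := Nat.le_of_dvd hm h
    omega
  have c1 : (1 : ZMod n) ≠ 0 := by simpa using hcast 1 (by norm_num) (by norm_num)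
  have c2 : (2 : ZMod n) ≠ 0 := by simpa using hcast 2 (by norm_num) (by norm_num)
  have c3 : (3 : ZMod n) ≠ 0 := by simpa using hcast 3 (by norm_num) (by norm_num)
  have hDW : WellFounded D := by
    apply wf_of_acyclic
    intro v hv
    obtain ⟨w, h1, h2⟩ := Relation.TransGen.head'_iff.1 hv
    exact hCG ⟨v, w, h1, Relation.ReflTransGen.mono (fun a b h => Or.inl h) _ _ h2⟩
  let Q : V → V → Prop := fun a b => D a b ∨ B.Adj a b
  have hreach : ∀ k l, Relation.ReflTransGen Q (f k) (f l) := by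
    intro k l
    have : ∀ m : ℕ, Relation.ReflTransGen Q (f k) (f (k + m)) := by
      intro m
      induction m with
      | zero => simpa using Relation.ReflTransGen.refl
      | succ m ih =>
        refine ih.tail (Or.inr ?_)
        have := hadj (k + m)
        rwa [add_assoc, ← Nat.cast_succ] at this
    have := this (l - k).val
    rwa [ZMod.natCast_zmod_val, add_sub_cancel] at this
  let R : V → Prop := fun v => ∃ k, Relation.ReflTransGen Q (f k) v
  have hR : ∀ a b, D a b ∨ B.Adj a b → R a → R b := by
    rintro a b h ⟨k, hk⟩
    exact ⟨k, hk.tail h⟩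
  have hRf : ∀ k, R (f k) := fun k => ⟨k, .refl⟩
  have hpa : ∀ k v, D v (f k) → ¬ R v := by
    rintro k v hv ⟨l, hl⟩
    exact hCG ⟨v, f k, hv, (hreach k l).trans hl⟩
  obtain ⟨U, iF, iD, ι, E, hE, heq⟩ := hS
  have hEW := wf_of_acyclic hE
  let e : {v // ¬ R v} → U := fun w => ι w.1
  have he : Function.Injective e := fun a b h => Subtype.ext (ι.injective h)
  have hei : ∀ k w, e w ≠ ι (f k) := by
    intro k w h
    have := ι.injective h
    exact w.2 (this ▸ hRf k)
  have hoel : ∀ c a, oel e (ι c) a = ι (oel Subtype.val c a) := by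
    intro c a; cases a <;> rfl
  have hnc : ∀ k l, k ≠ l → l ≠ k + 1 → k ≠ l + 1 →
      ¬ ∃ u v, RAv e E u (ι (f k)) ∧ Relation.ReflTransGen (LAv e E) u v ∧
        RAv e E v (ι (f l)) := by
    intro k l h1 h2 h3
    apply no_conn hEW e he _ _ (hei k) (hei l)
    intro S hS
    have hS' : S.submatrix ι ι ∈ MixedCov D B := by
      rw [← heq]; exact ⟨S, hS, rfl⟩
    have := mixed_det hDW R hR (f k) (f l) (hRf l) (fun h => h1 (hf h)) (hna k l h1 h2 h3)
      (hpa k) (hpa l) _ hS'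
    simp only [hoel]
    exact this
  obtain ⟨s, Ω0, hs, hpd, hBs, hoff, hval⟩ := cyc_matrix B c1 c2 f hf hadj
  obtain ⟨δ, hδ, hpd'⟩ := posDef_sub hpd
  have hmem : (Ω0 - δ • (1 : Matrix V V ℝ)) ∈ MixedCov D B := by
    refine ⟨0, _, fun _ _ _ => rfl, hpd', ?_, by simp⟩
    intro u v huv hnadj
    simp [hBs u v huv hnadj, Matrix.one_apply_ne huv]
  rw [← heq] at hmem
  obtain ⟨S, ⟨Λ, Ω, hΛ, hdiag, hpos, rfl⟩, hsub⟩ := hmem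
  have hent : ∀ a b, ∑ u, Ω u u * (1 - Λ)⁻¹ u (ι a) * (1 - Λ)⁻¹ u (ι b) =
      (Ω0 - δ • (1 : Matrix V V ℝ)) a b := by
    intro a b
    rw [← hsub, ← cov_entry hdiag]; rfl
  have hsupp : ∀ u k, (1 - Λ)⁻¹ u (ι (f k)) ≠ 0 →
      ∃ v, Relation.ReflTransGen (LAv e E) u v ∧ RAv e E v (ι (f k)) := by
    intro u k hne
    by_contra hno
    apply hne
    apply supp_resid hEW e (ι (f k)) hΛ (fun u => Ω u u) hpos _ u hno
    intro p
    have h1 : ∀ l, f l ≠ p.1 := fun l h => p.2 (h ▸ hRf l)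
    rw [show e p = ι p.1 from rfl, hent]
    simp [hoff k p.1 h1, Matrix.one_apply_ne (h1 k)]
  have hsymm : ∀ u v, Relation.ReflTransGen (LAv e E) u v → Relation.ReflTransGen (LAv e E) v u := by
    intro u v h
    induction h with
    | refl => exact .refl
    | tail _ h2 ih => exact ih.head (LAv_symm h2)
  have hineq : ∀ u, 0 ≤ ∑ k, ((1 - Λ)⁻¹ u (ι (f k)) ^ 2 -
      2 * (s k * ((1 - Λ)⁻¹ u (ι (f k)) * (1 - Λ)⁻¹ u (ι (f (k + 1)))))) := by
    intro u
    apply cyc_ineq c1 c2 c3 (fun k => (1 - Λ)⁻¹ u (ι (f k))) s hs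
    intro k l hk hl
    by_contra hno
    push Not at hno
    obtain ⟨v, hv1, hv2⟩ := hsupp u k hk
    obtain ⟨w, hw1, hw2⟩ := hsupp u l hl
    exact hnc k l hno.1 hno.2.1 hno.2.2 ⟨v, w, hv2, (hsymm _ _ hv1).trans hw1, hw2⟩
  have htot : 0 ≤ ∑ u, Ω u u * ∑ k, ((1 - Λ)⁻¹ u (ι (f k)) ^ 2 -
      2 * (s k * ((1 - Λ)⁻¹ u (ι (f k)) * (1 - Λ)⁻¹ u (ι (f (k + 1)))))) :=
    Finset.sum_nonneg fun u _ => mul_nonneg (hpos u).le (hineq u)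
  have hcalc : ∑ u, Ω u u * ∑ k, ((1 - Λ)⁻¹ u (ι (f k)) ^ 2 -
      2 * (s k * ((1 - Λ)⁻¹ u (ι (f k)) * (1 - Λ)⁻¹ u (ι (f (k + 1)))))) =
      ∑ k : ZMod n, -δ := by
    simp only [Finset.mul_sum]
    rw [Finset.sum_comm]
    apply Finset.sum_congr rfl
    intro k _
    have e1 := hent (f k) (f k)
    have e2 := hent (f k) (f (k + 1))
    have hne : f k ≠ f (k + 1) := (hadj k).ne
    simp only [Matrix.sub_apply, Matrix.smul_apply, Matrix.one_apply_eq,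
      Matrix.one_apply_ne hne, (hval k).1, (hval k).2, smul_eq_mul, mul_one, mul_zero,
      sub_zero] at e1 e2
    have e3 : ∀ u, Ω u u * ((1 - Λ)⁻¹ u (ι (f k)) ^ 2 -
      2 * (s k * ((1 - Λ)⁻¹ u (ι (f k)) * (1 - Λ)⁻¹ u (ι (f (k + 1)))))) =
      Ω u u * (1 - Λ)⁻¹ u (ι (f k)) * (1 - Λ)⁻¹ u (ι (f k)) -
      2 * s k * (Ω u u * (1 - Λ)⁻¹ u (ι (f k)) * (1 - Λ)⁻¹ u (ι (f (k + 1)))) :=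
      fun u => by ring
    rw [Finset.sum_congr rfl fun u _ => e3 u, Finset.sum_sub_distrib, ← Finset.mul_sum, e1, e2]
    have := hs k
    linear_combination -2 * this
  rw [hcalc] at htot
  simp only [Finset.sum_const, Finset.card_univ, ZMod.card, smul_neg, nsmul_eq_mul] at htot
  have : (0:ℝ) < n := by exact_mod_cast (by omega : 0 < n)
  have := mul_pos this hδ
  linarith

end Part3

section Part4

lemma no_hole {V : Type} {B : SimpleGraph V} (hB : Chordal B) (C : V → Prop) (v x y : V)
    (hvC : ∀ c, C c → c ≠ v ∧ ¬ B.Adj v c) (hxC : ¬ C x) (hyC : ¬ C y)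
    (hvx : B.Adj v x) (hvy : B.Adj v y) (hxy : x ≠ y) (hnxy : ¬ B.Adj x y)
    (hpath : ∃ c d, (C c ∧ B.Adj x c) ∧
      Relation.ReflTransGen (fun a b => B.Adj a b ∧ C a ∧ C b) c d ∧ (C d ∧ B.Adj y d)) :
    False := by
  obtain ⟨m, u, hu0, hum, hlink, hA, hC, hshort⟩ := exists_min_chain
    (fun a b => B.Adj a b ∧ C a ∧ C b) (fun c => C c ∧ B.Adj x c) (fun d => C d ∧ B.Adj y d) hpath
  have huC : ∀ k ≤ m, C (u k) := by
    intro k hk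
    cases k with
    | zero => exact hu0.1
    | succ k => exact (hlink k (by omega)).2.2
  have huinj : ∀ a b, a < b → b ≤ m → u a ≠ u b := by
    intro a b hab hbm h
    rcases Nat.lt_or_ge b m with hb | hb
    · have h1 := hlink b hb
      rw [← h] at h1
      have := hshort a (b + 1) (by omega) (by omega) h1
      omega
    · have e : b = m := by omega
      rw [← e, ← h] at hum
      have := hC a (by omega) hum
      omega
  obtain ⟨g, g0, g1, gu, gy⟩ : ∃ g : ℕ → V, g 0 = v ∧ g 1 = x ∧ (∀ k ≤ m, g (k + 2) = u k) ∧
      g (m + 3) = y := by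
    refine ⟨fun k => if k = 0 then v else if k = 1 then x else if k - 2 ≤ m then u (k - 2) else y,
      by simp, by simp, ?_, ?_⟩
    · intro k hk
      simp [hk]
    · have : ¬ (m + 3 - 2 ≤ m) := by omega
      simp [this]
  have hcase : ∀ b ≤ m + 3, b = 0 ∨ b = 1 ∨ (∃ k ≤ m, b = k + 2) ∨ b = m + 3 := by
    intro b hb
    by_cases h : b < 2
    · omega
    · by_cases h2 : b = m + 3
      · omega
      · exact Or.inr (Or.inr (Or.inl ⟨b - 2, by omega, by omega⟩))
  have hsucc : ∀ k < m + 3, B.Adj (g k) (g (k + 1)) := by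
    intro k hk
    rcases hcase k hk.le with rfl | rfl | ⟨l, hl, rfl⟩ | h
    · rw [g0, g1]; exact hvx
    · rw [g1, gu 0 (by omega)]; exact hu0.2
    · rw [gu l hl]
      rcases Nat.lt_or_ge l m with h | h
      · have := gu (l + 1) h
        rw [show l + 2 + 1 = l + 1 + 2 by omega, this]
        exact (hlink l h).1
      · have e : l = m := by omega
        subst e
        rw [show l + 2 + 1 = l + 3 by omega, gy]
        exact hum.2.symm
    · omega
  have hlast : B.Adj (g (m + 3)) (g 0) := by rw [gy, g0]; exact hvy.symm
  have hinj : ∀ a b, a < b → b ≤ m + 3 → g a ≠ g b := by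
    intro a b hab hb
    rcases hcase a (by omega) with rfl | rfl | ⟨l, hl, rfl⟩ | h <;>
    rcases hcase b hb with h' | h' | ⟨k, hk, h'⟩ | h' <;> subst h' <;> try omega
    · rw [g0, g1]; exact hvx.ne
    · rw [g0, gu k hk]; exact (hvC _ (huC k hk)).1.symm
    · rw [g0, gy]; exact hvy.ne
    · rw [g1, gu k hk]; intro h; exact hxC (h ▸ huC k hk)
    · rw [g1, gy]; exact hxy
    · rw [gu l hl, gu k hk]; exact huinj _ _ (by omega) hk
    · rw [gu l hl, gy]; intro h; exact hyC (h ▸ huC l hl)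
  have hch : ∀ a b, a < b → b ≤ m + 3 → B.Adj (g a) (g b) → b = a + 1 ∨ (a = 0 ∧ b = m + 3) := by
    intro a b hab hb
    rcases hcase a (by omega) with rfl | rfl | ⟨l, hl, rfl⟩ | h <;>
    rcases hcase b hb with h' | h' | ⟨k, hk, h'⟩ | h' <;> subst h' <;> try omega
    · rw [g0, gu k hk]; intro h; exact absurd h (hvC _ (huC k hk)).2
    · rw [g1, gu k hk]; intro h
      have := hA k hk ⟨huC k hk, h⟩
      omega
    · rw [g1, gy]; intro h; exact absurd h hnxy
    · rw [gu l hl, gu k hk]; intro h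
      have := hshort l k (by omega) hk ⟨h, huC _ hl, huC _ hk⟩
      omega
    · rw [gu l hl, gy]; intro h
      have := hC l hl ⟨huC _ hl, h.symm⟩
      omega
  have hzero : ((m + 3 : ℕ) : ZMod (m + 4)) + 1 = 0 := by
    have := ZMod.natCast_self (m + 4)
    rw [← this]; push_cast; ring
  have hvl : ∀ i : ZMod (m + 4), i.val ≤ m + 3 := fun i => by
    have := ZMod.val_lt i; omega
  have hcst : ∀ i : ZMod (m + 4), ((i.val : ℕ) : ZMod (m + 4)) = i := ZMod.natCast_zmod_val
  have key : ∀ i j : ZMod (m + 4), i.val < j.val → B.Adj (g i.val) (g j.val) →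
      j = i + 1 ∨ i = j + 1 := by
    intro i j hij h
    rcases hch _ _ hij (hvl j) h with h' | ⟨h1, h2⟩
    · left
      rw [← hcst j, h', Nat.cast_succ, hcst]
    · right
      rw [← hcst j, h2, hzero, ← hcst i, h1, Nat.cast_zero]
  obtain ⟨i, j, h1, h2, h3, h4⟩ := hB (m + 4) (by omega) (fun z => g z.val) (by
    intro i j hij
    have hij : g i.val = g j.val := hij
    rcases lt_trichotomy i.val j.val with h | h | h
    · exact absurd hij (hinj _ _ h (hvl j))
    · exact ZMod.val_injective _ h
    · exact absurd hij.symm (hinj _ _ h (hvl i))) (by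
    intro i
    change B.Adj (g i.val) (g (i + 1).val)
    rcases Nat.lt_or_ge i.val (m + 3) with h | h
    · have : (i + 1).val = i.val + 1 := by
        have e : i + 1 = ((i.val + 1 : ℕ) : ZMod (m + 4)) := by rw [Nat.cast_succ, hcst]
        rw [e, ZMod.val_natCast, Nat.mod_eq_of_lt (by omega)]
      rw [this]; exact hsucc _ h
    · have h' : i.val = m + 3 := le_antisymm (hvl i) h
      have : i + 1 = 0 := by rw [← hcst i, h', hzero]
      rw [this, h', ZMod.val_zero]; exact hlast)
  have h4 : B.Adj (g i.val) (g j.val) := h4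
  rcases lt_trichotomy i.val j.val with h | h | h
  · rcases key _ _ h h4 with h | h
    · exact h1 h
    · exact h2 h
  · exact h3 (ZMod.val_injective _ h)
  · rcases key _ _ h h4.symm with h | h
    · exact h2 h
    · exact h1 h

def Simp {V : Type} (B : SimpleGraph V) (W : Finset V) (t : V) : Prop :=
  t ∈ W ∧ ∀ a ∈ W, ∀ b ∈ W, B.Adj t a → B.Adj t b → a ≠ b → B.Adj a b

def DiracP {V : Type} (B : SimpleGraph V) (W : Finset V) : Prop :=
  ∀ v ∈ W, (∃ w ∈ W, w ≠ v ∧ ¬ B.Adj v w) → ∃ t, Simp B W t ∧ t ≠ v ∧ ¬ B.Adj v t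

lemma DiracP.exists {V : Type} {B : SimpleGraph V} {W : Finset V} (h : DiracP B W)
    (hW : W.Nonempty) : ∃ t, Simp B W t := by
  by_cases hc : ∃ v ∈ W, ∃ w ∈ W, w ≠ v ∧ ¬ B.Adj v w
  · obtain ⟨v, hv, hw⟩ := hc
    obtain ⟨t, ht, _⟩ := h v hv hw
    exact ⟨t, ht⟩
  · obtain ⟨t, ht⟩ := hW
    refine ⟨t, ht, fun a ha b hb _ _ hab => ?_⟩
    by_contra hn
    exact hc ⟨a, ha, b, hb, hab.symm, hn⟩

lemma dirac {V : Type} [DecidableEq V] {B : SimpleGraph V} (hB : Chordal B) :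
    ∀ (N : ℕ) (W : Finset V), W.card < N → DiracP B W := by
  classical
  intro N
  induction N with
  | zero => intro W h; omega
  | succ N ih =>
    rintro W hW v hv ⟨w, hw, hwv, hvw⟩
    let C : Finset V := W.filter fun c =>
      Relation.ReflTransGen (fun a b => B.Adj a b ∧ b ∈ W ∧ b ≠ v ∧ ¬ B.Adj v b) w c
    have hCmem : ∀ c, c ∈ C ↔ c ∈ W ∧
      Relation.ReflTransGen (fun a b => B.Adj a b ∧ b ∈ W ∧ b ≠ v ∧ ¬ B.Adj v b) w c := by
      simp [C]
    have hwC : w ∈ C := (hCmem w).2 ⟨hw, .refl⟩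
    have hCv : ∀ c ∈ C, c ≠ v ∧ ¬ B.Adj v c := by
      intro c hc
      rcases Relation.ReflTransGen.cases_tail ((hCmem c).1 hc).2 with h | ⟨b, _, hb⟩
      · rw [h]; exact ⟨hwv, hvw⟩
      · exact hb.2.2
    have hCext : ∀ c ∈ C, ∀ b ∈ W, B.Adj c b → b ≠ v → ¬ B.Adj v b → b ∈ C := by
      intro c hc b hb h1 h2 h3
      exact (hCmem b).2 ⟨hb, ((hCmem c).1 hc).2.tail ⟨h1, hb, h2, h3⟩⟩
    -- connectivity inside `C`
    have hCw : ∀ c ∈ C, Relation.ReflTransGen (fun a b => B.Adj a b ∧ a ∈ C ∧ b ∈ C) w c := by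
      intro c hc
      have hc2 := ((hCmem c).1 hc).2
      clear hc
      induction hc2 with
      | refl => exact .refl
      | @tail b d hb hd ih2 =>
        have hbW : b ∈ W := by
          rcases Relation.ReflTransGen.cases_tail hb with h | ⟨_, _, h⟩
          · rw [h]; exact hw
          · exact h.2.1
        have hbC : b ∈ C := (hCmem b).2 ⟨hbW, hb⟩
        exact ih2.tail ⟨hd.1, hbC, hCext b hbC d hd.2.1 hd.1 hd.2.2.1 hd.2.2.2⟩
    have hCsym : ∀ c d, Relation.ReflTransGen (fun a b => B.Adj a b ∧ a ∈ C ∧ b ∈ C) c d →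
        Relation.ReflTransGen (fun a b => B.Adj a b ∧ a ∈ C ∧ b ∈ C) d c := by
      intro c d h
      induction h with
      | refl => exact .refl
      | tail _ h2 ih2 => exact ih2.head ⟨h2.1.symm, h2.2.2, h2.2.1⟩
    let S : Finset V := W.filter fun x => x ∉ C ∧ ∃ c ∈ C, B.Adj x c
    have hSmem : ∀ x, x ∈ S ↔ x ∈ W ∧ x ∉ C ∧ ∃ c ∈ C, B.Adj x c := by simp [S]
    have hSv : ∀ x ∈ S, B.Adj v x := by
      intro x hx
      obtain ⟨h1, h2, c, hc, h3⟩ := (hSmem x).1 hx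
      by_contra hn
      apply h2
      apply hCext c hc x h1 h3.symm _ hn
      rintro rfl
      exact (hCv c hc).2 h3
    have hScl : ∀ x ∈ S, ∀ y ∈ S, x ≠ y → B.Adj x y := by
      intro x hx y hy hxy
      by_contra hn
      obtain ⟨_, x2, c, hc, hxc⟩ := (hSmem x).1 hx
      obtain ⟨_, y2, d, hd, hyd⟩ := (hSmem y).1 hy
      exact no_hole hB (fun c => c ∈ C) v x y hCv x2 y2 (hSv x hx) (hSv y hy) hxy hn
        ⟨c, d, ⟨hc, hxc⟩, (hCsym _ _ (hCw c hc)).trans (hCw d hd), ⟨hd, hyd⟩⟩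
    have hCW : C ⊆ W := Finset.filter_subset _ _
    have hSW : S ⊆ W := Finset.filter_subset _ _
    have hvC : v ∉ C := fun h => (hCv v h).1 rfl
    have hvS : v ∉ S := fun h => (hSv v h).ne rfl
    have hcC : C.card < W.card := Finset.card_lt_card
      ((Finset.ssubset_iff_of_subset hCW).2 ⟨v, hv, hvC⟩)
    have hcCS : (C ∪ S).card < W.card := Finset.card_lt_card
      ((Finset.ssubset_iff_of_subset (Finset.union_subset hCW hSW)).2
        ⟨v, hv, by simp [hvC, hvS]⟩)
    have hsimp : ∃ t ∈ C, Simp B (C ∪ S) t := by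
      by_cases hA : ∃ x ∈ S, ∃ y ∈ C ∪ S, y ≠ x ∧ ¬ B.Adj x y
      · obtain ⟨x, hx, hy⟩ := hA
        obtain ⟨t, ht, htx, hxt⟩ := ih (C ∪ S) (by omega) x (Finset.mem_union_right _ hx) hy
        refine ⟨t, ?_, ht⟩
        rcases Finset.mem_union.1 ht.1 with h | h
        · exact h
        · exact absurd (hScl x hx t h htx.symm) hxt
      · have hdom : ∀ x ∈ S, ∀ y ∈ C ∪ S, y ≠ x → B.Adj x y := by
          intro x hx y hy hyx
          by_contra hn
          exact hA ⟨x, hx, y, hy, hyx, hn⟩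
        obtain ⟨t, ht⟩ := (ih C (by omega)).exists ⟨w, hwC⟩
        refine ⟨t, ht.1, Finset.mem_union_left _ ht.1, ?_⟩
        intro a ha b hb hta htb hab
        rcases Finset.mem_union.1 ha with ha' | ha'
        · rcases Finset.mem_union.1 hb with hb' | hb'
          · exact ht.2 a ha' b hb' hta htb hab
          · exact (hdom b hb' a ha hab).symm
        · exact hdom a ha' b hb hab.symm
    obtain ⟨t, htC, ht⟩ := hsimp
    refine ⟨t, ⟨hCW htC, ?_⟩, (hCv t htC).1, (hCv t htC).2⟩
    have hnb : ∀ a ∈ W, B.Adj t a → a ∈ C ∪ S := by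
      intro a ha hta
      by_cases h : a ∈ C
      · exact Finset.mem_union_left _ h
      · exact Finset.mem_union_right _ ((hSmem a).2 ⟨ha, h, t, htC, hta.symm⟩)
    intro a ha b hb hta htb hab
    exact ht.2 a (hnb a ha hta) b (hnb b hb htb) hta htb hab

end Part4

section Part5

lemma psd_row_zero {V : Type} [Fintype V] [DecidableEq V] {Ω : Matrix V V ℝ}
    (h : Ω.PosSemidef) (k : V) (hk : Ω k k = 0) (i : V) : Ω i k = 0 := by
  have h1 := (h.dotProduct_mulVec_zero_iff (Pi.single k 1)).1 (by simp [hk])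
  have := congrFun h1 i
  simpa using this

lemma psd_sym {V : Type} {Ω : Matrix V V ℝ}
    (h : Ω.PosSemidef) (i j : V) : Ω i j = Ω j i := by
  simpa using h.1.apply j i

lemma psd_elim {V : Type} [Fintype V] [DecidableEq V] {Ω : Matrix V V ℝ}
    (h : Ω.PosSemidef) (k : V) :
    (Ω - (Ω k k)⁻¹ • vecMulVec (Ω k) (Ω k)).PosSemidef := by
  set c := (Ω k k)⁻¹ with hc
  set r : V → ℝ := Ω k with hr
  set e : V → ℝ := Pi.single k 1 with he
  have h1 : Ω *ᵥ e = r := by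
    ext i
    simp [he, hr, psd_sym h i k]
  have h2 : Ω * (1 - c • vecMulVec e r) = Ω - c • vecMulVec r r := by
    rw [mul_sub, mul_one, Matrix.mul_smul, mul_vecMulVec, h1]
  have h3 : (1 - c • vecMulVec e r)ᴴ = 1 - c • vecMulVec r e := by
    ext i j
    simp [vecMulVec, Matrix.one_apply, eq_comm, mul_comm]
  have h4 : c • vecMulVec r e * (Ω - c • vecMulVec r r) = 0 := by
    ext i j
    simp only [Matrix.smul_mul, vecMulVec_mul, he, Matrix.single_one_vecMul]
    simp only [Matrix.smul_apply, vecMulVec_apply, Matrix.zero_apply, smul_eq_mul,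
      Matrix.sub_apply, Matrix.row]
    by_cases h0 : Ω k k = 0
    · have hc0 : c = 0 := by rw [hc]; exact inv_eq_zero.2 h0
      simp [hc0]
    · have : r k = Ω k k := rfl
      have : r j = Ω k j := rfl
      simp [hr, hc, h0]
  have h5 := h.conjTranspose_mul_mul_same (1 - c • vecMulVec e r)
  rw [Matrix.mul_assoc, h2, h3, sub_mul, h4, one_mul, sub_zero] at h5
  exact h5

lemma chol {V : Type} [Fintype V] [DecidableEq V] {B : SimpleGraph V} (hB : Chordal B) :
    ∀ (n : ℕ) (W : Finset V), W.card = n → ∃ Q : V → V → Prop,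
      (∀ k i, Q k i → k ∈ W) ∧ (∀ k i j, Q k i → Q k j → i ≠ j → B.Adj i j) ∧
      ∀ Ω : Matrix V V ℝ, Ω.PosSemidef → BSupported B Ω → (∀ u v, u ∉ W → Ω u v = 0) →
        ∃ L : Matrix V V ℝ, SupportedOn Q L ∧ Ω = Lᵀ * L := by
  intro n
  induction n with
  | zero =>
    intro W hW
    rw [Finset.card_eq_zero] at hW
    subst hW
    refine ⟨fun _ _ => False, fun _ _ h => h.elim, fun _ _ _ h => h.elim, ?_⟩
    intro Ω _ _ h
    refine ⟨0, fun _ _ _ => rfl, ?_⟩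
    ext u v
    simp [h]
  | succ n ih =>
    intro W hW
    obtain ⟨k, hkW, hk⟩ := (dirac hB (W.card + 1) W (by omega)).exists
      (Finset.card_pos.1 (by omega))
    obtain ⟨Q, hQ1, hQ2, hQ3⟩ := ih (W.erase k) (by rw [Finset.card_erase_of_mem hkW, hW]; rfl)
    refine ⟨fun a i => Q a i ∨ (a = k ∧ (i = k ∨ (i ∈ W ∧ B.Adj k i))), ?_, ?_, ?_⟩
    · rintro a i (h | ⟨rfl, _⟩)
      · exact Finset.mem_of_mem_erase (hQ1 a i h)
      · exact hkW
    · rintro a i j (h | ⟨rfl, h⟩) (h' | ⟨h1, h'⟩) hij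
      · exact hQ2 a i j h h' hij
      · exact absurd h1 (Finset.ne_of_mem_erase (hQ1 a i h))
      · exact absurd rfl (Finset.ne_of_mem_erase (hQ1 _ _ h'))
      · rcases h with rfl | ⟨hi, h⟩ <;> rcases h' with rfl | ⟨hj, h'⟩
        · exact absurd rfl hij
        · exact h'
        · exact h.symm
        · exact hk i hi j hj h h' hij
    · intro Ω hΩ hBΩ hsup
      have hsup2 : ∀ v, v ∉ W → Ω k v = 0 := fun v hv => by rw [psd_sym hΩ, hsup v k hv]
      have hps := psd_elim hΩ k
      obtain ⟨L, hL1, hL2⟩ := hQ3 _ hps (by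
        intro u v huv hn
        simp only [Matrix.sub_apply, Matrix.smul_apply, vecMulVec_apply, smul_eq_mul]
        rw [hBΩ u v huv hn]
        by_cases h0 : Ω k u = 0
        · simp [h0]
        by_cases h1 : Ω k v = 0
        · simp [h1]
        exfalso
        have hu : u ∈ W := by by_contra h; exact h0 (hsup2 u h)
        have hv : v ∈ W := by by_contra h; exact h1 (hsup2 v h)
        have a1 : k = u ∨ B.Adj k u := by
          by_contra h; push Not at h; exact h0 (hBΩ k u h.1 h.2)
        have a2 : k = v ∨ B.Adj k v := by
          by_contra h; push Not at h; exact h1 (hBΩ k v h.1 h.2)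
        rcases a1 with rfl | a1 <;> rcases a2 with rfl | a2
        · exact huv rfl
        · exact hn a2
        · exact hn a1.symm
        · exact hn (hk u hu v hv a1 a2 huv)) (by
        intro u v hu
        simp only [Matrix.sub_apply, Matrix.smul_apply, vecMulVec_apply, smul_eq_mul]
        by_cases huk : u = k
        · subst huk
          by_cases h0 : Ω u u = 0
          · rw [psd_sym hΩ u v, psd_row_zero hΩ u h0 v]; simp
          · field_simp; simp
        · have : u ∉ W := fun h => hu (Finset.mem_erase.2 ⟨huk, h⟩)
          rw [hsup u v this, hsup2 u this]; simp)
      have hLk : ∀ i, L k i = 0 := fun i => hL1 k i fun h =>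
        Finset.ne_of_mem_erase (hQ1 k i h) rfl
      set s := √(Ω k k) with hs
      refine ⟨Matrix.of fun a i => L a i + if a = k then Ω k i / s else 0, ?_, ?_⟩
      · intro a i h
        push Not at h
        have h1 := hL1 a i h.1
        by_cases hak : a = k
        · have h2 := h.2 hak
          have : Ω k i = 0 := by
            by_cases hi : i ∈ W
            · exact hBΩ k i (Ne.symm h2.1) (h2.2 hi)
            · exact hsup2 i hi
          simp [h1, this]
        · simp [h1, hak]
      · ext i j
        have h1 := congrFun (congrFun hL2 i) j
        simp only [Matrix.sub_apply, Matrix.smul_apply, vecMulVec_apply, smul_eq_mul,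
          Matrix.mul_apply, Matrix.transpose_apply] at h1
        rw [sub_eq_iff_eq_add] at h1
        rw [h1]
        simp only [Matrix.mul_apply, Matrix.transpose_apply, Matrix.of_apply]
        have h2 : ∀ a, (L a i + if a = k then Ω k i / s else 0) *
            (L a j + if a = k then Ω k j / s else 0) =
            L a i * L a j + if a = k then (Ω k k)⁻¹ * (Ω k i * Ω k j) else 0 := by
          intro a
          by_cases ha : a = k
          · subst ha
            have : s * s = Ω a a := Real.mul_self_sqrt hΩ.diag_nonneg
            simp only [hLk, if_true, ← this, mul_inv]
            ring
          · simp [ha]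
        simp only [h2, Finset.sum_add_distrib]
        simp

lemma block_cov {V : Type} [Fintype V] [DecidableEq V] (Λ L N Δ : Matrix V V ℝ)
    (h : IsUnit (1 - Λ).det) :
    (((1 - fromBlocks Λ 0 L 0 : Matrix (V ⊕ V) (V ⊕ V) ℝ)⁻¹)ᵀ * fromBlocks N 0 0 Δ *
      (1 - fromBlocks Λ 0 L 0 : Matrix (V ⊕ V) (V ⊕ V) ℝ)⁻¹).submatrix
      (Sum.inl : V → V ⊕ V) Sum.inl = ((1 - Λ)⁻¹)ᵀ * (N + Lᵀ * Δ * L) * (1 - Λ)⁻¹ := by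
  have h1 : (1 - fromBlocks Λ 0 L 0 : Matrix (V ⊕ V) (V ⊕ V) ℝ)⁻¹ = fromBlocks (1 - Λ)⁻¹ 0 (L * (1 - Λ)⁻¹) 1 := by
    apply Matrix.inv_eq_right_inv
    rw [← fromBlocks_one, sub_eq_add_neg, fromBlocks_neg, fromBlocks_add, fromBlocks_multiply]
    simp [← sub_eq_add_neg, Matrix.mul_nonsing_inv _ h]
  rw [h1, fromBlocks_transpose, fromBlocks_multiply, fromBlocks_multiply]
  ext i j
  simp only [submatrix_apply, fromBlocks_apply₁₁]
  apply congrFun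
  apply congrFun
  simp only [transpose_zero, transpose_mul, zero_mul, mul_zero, add_zero, zero_add, Matrix.mul_add,
    Matrix.add_mul, Matrix.mul_assoc, Matrix.zero_mul, Matrix.mul_zero]
  rfl

lemma backward {V : Type} [Fintype V] [DecidableEq V] (D : V → V → Prop)
    (B : SimpleGraph V) (hCG : ChainGraph D B) (hB : Chordal B) :
    StrictlyGaussianCausal D B := by
  have hDA : Acyclic D := by
    intro v hv
    obtain ⟨w, h1, h2⟩ := Relation.TransGen.head'_iff.1 hv
    exact hCG ⟨v, w, h1, Relation.ReflTransGen.mono (fun a b h => Or.inl h) _ _ h2⟩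
  have hDW : WellFounded D := wf_of_acyclic hDA
  obtain ⟨Q, _, hQ2, hQ3⟩ := chol hB _ (Finset.univ : Finset V) rfl
  let E : V ⊕ V → V ⊕ V → Prop := fun a b => match a, b with
    | .inl a, .inl b => D a b
    | .inr k, .inl i => Q k i
    | _, .inr _ => False
  refine ⟨V ⊕ V, inferInstance, inferInstance, Function.Embedding.inl, E, ?_, ?_⟩
  · have key : ∀ a y, Relation.TransGen E (Sum.inl a) y → ∃ b, y = Sum.inl b ∧
        Relation.TransGen D a b := by
      intro a y h
      induction h with
      | @single y h =>
        cases y with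
        | inl b => exact ⟨b, rfl, .single h⟩
        | inr b => exact h.elim
      | @tail y z _ h ih =>
        obtain ⟨b, rfl, hb⟩ := ih
        cases z with
        | inl c => exact ⟨c, rfl, hb.tail h⟩
        | inr c => exact h.elim
    intro v hv
    cases v with
    | inl a =>
      obtain ⟨b, h1, h2⟩ := key a _ hv
      cases h1
      exact hDA a h2
    | inr k =>
      obtain ⟨w, _, h⟩ := Relation.TransGen.tail'_iff.1 hv
      cases w <;> exact h.elim
  · ext S
    constructor
    · rintro ⟨S', ⟨Λ', Ω', hΛ', hd, hp, rfl⟩, rfl⟩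
      have e1 : Λ' = fromBlocks Λ'.toBlocks₁₁ 0 Λ'.toBlocks₂₁ 0 := by
        ext (i | i) (j | j)
        · rfl
        · exact hΛ' _ _ (fun h => h)
        · rfl
        · exact hΛ' _ _ (fun h => h)
      have e2 : Ω' = fromBlocks Ω'.toBlocks₁₁ 0 0 Ω'.toBlocks₂₂ := by
        ext (i | i) (j | j)
        · rfl
        · exact hd (by simp)
        · exact hd (by simp)
        · rfl
      have hΛ : SupportedOn D Λ'.toBlocks₁₁ := fun u v h => hΛ' _ _ h
      have hL : SupportedOn Q Λ'.toBlocks₂₁ := fun u v h => hΛ' _ _ h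
      have hN : Ω'.toBlocks₁₁ = Matrix.diagonal fun i => Ω' (.inl i) (.inl i) := by
        ext i j
        by_cases h : i = j
        · subst h; simp [toBlocks₁₁]
        · simp only [Matrix.diagonal_apply_ne _ h]
          exact hd (by simpa using h)
      have hM : Ω'.toBlocks₂₂ = Matrix.diagonal fun i => Ω' (.inr i) (.inr i) := by
        ext i j
        by_cases h : i = j
        · subst h; simp [toBlocks₂₂]
        · simp only [Matrix.diagonal_apply_ne _ h]
          exact hd (by simpa using h)
      generalize Λ'.toBlocks₁₁ = Λ at *
      generalize Λ'.toBlocks₂₁ = L at *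
      generalize Ω'.toBlocks₁₁ = N at *
      generalize Ω'.toBlocks₂₂ = Δ at *
      refine ⟨Λ, N + Lᵀ * Δ * L, hΛ, ?_, ?_, ?_⟩
      · apply Matrix.PosDef.add_posSemidef
        · rw [hN]
          exact Matrix.PosDef.diagonal fun i => hp _
        · have : Δ.PosSemidef := by
            rw [hM]
            exact Matrix.PosSemidef.diagonal fun i => (hp _).le
          simpa using this.conjTranspose_mul_mul_same L
      · intro u v huv hn
        rw [hM, hN]
        simp only [Matrix.add_apply, Matrix.diagonal_apply_ne _ huv,
          Matrix.mul_apply (M := Lᵀ * _), Matrix.mul_diagonal, Matrix.transpose_apply, zero_add]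
        apply Finset.sum_eq_zero
        intro k _
        by_cases h1 : Q k u
        · have h2 : ¬ Q k v := fun h2 => hn (hQ2 k u v h1 h2 huv)
          rw [hL k v h2]; simp
        · rw [hL k u h1]; simp
      · have := block_cov Λ L N Δ (det_one_sub hDW hΛ)
        rw [← e1, ← e2] at this
        exact this
    · rintro ⟨Λ, Ω, hΛ, hΩ, hBΩ, rfl⟩
      obtain ⟨δ, hδ, hpd⟩ := posDef_sub hΩ
      obtain ⟨L, hL, hLL⟩ := hQ3 _ hpd.posSemidef (by
        intro u v huv hn
        simp [hBΩ u v huv hn, huv]) (fun u v h => absurd (Finset.mem_univ u) h)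
      refine ⟨_, ⟨fromBlocks Λ 0 L 0, fromBlocks (δ • 1) 0 0 1, ?_, ?_, ?_, rfl⟩, ?_⟩
      · rintro (u | u) (v | v) h
        · exact hΛ u v h
        · rfl
        · exact hL u v h
        · rfl
      · rintro (u | u) (v | v) h
        · have : u ≠ v := fun h' => h (by rw [h'])
          simp [this]
        · rfl
        · rfl
        · have : u ≠ v := fun h' => h (by rw [h'])
          simp [this]
      · rintro (u | u)
        · simpa using hδ
        · simp
      · have := block_cov Λ L (δ • 1) 1 (det_one_sub hDW hΛ)
        rw [Matrix.mul_one, ← hLL, add_sub_cancel] at this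
        exact this

end Part5

theorem stmt17 {V : Type} [Fintype V] [DecidableEq V] (D : V → V → Prop)
    (B : SimpleGraph V) (hCG : ChainGraph D B) :
    StrictlyGaussianCausal D B ↔ Chordal B := by
  exact ⟨forward D B hCG, backward D B hCG⟩
end
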